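/- (Riordan's theorem) Let (H_n) be a sequence of graphs with v(H_n) = n and e(H_n) > n/2, and let p = p(n) < 1 satisfy n·p^{m_R(H_n)} / Δ(H_n)^4 → ∞ as n → ∞. Then a.a.s. G(n,p) contains a copy of H_n. -/

import Mathlib

open MeasureTheory Filter Topology

/-- Bernoulli measure on `Bool` with success probability `p` (clamped to `[0,1]`). -/
noncomputable def bernoulliMeasure (p : ℝ) : Measure Bool :=
  (min (ENNReal.ofReal p) 1) • Measure.dirac true +
    (1 - min (ENNReal.ofReal p) 1) • Measure.dirac false

/-- The distribution of the binomial random graph `G(n,p)`, as a product of independent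
Bernoulli measures, one for each potential edge. -/
noncomputable def gnp (n : ℕ) (p : ℝ) : Measure (Sym2 (Fin n) → Bool) :=
  Measure.pi fun _ => bernoulliMeasure p

/-- The simple graph on `[n]` determined by an outcome of the edge indicators. -/
def graphOf {n : ℕ} (ω : Sym2 (Fin n) → Bool) : SimpleGraph (Fin n) :=
  SimpleGraph.fromRel fun u v => ω s(u, v) = true

/-- `G` contains a (not necessarily induced) copy of `H`. -/
def ContainsCopy {α β : Type*} (H : SimpleGraph α) (G : SimpleGraph β) : Prop :=
  ∃ f : α → β, Function.Injective f ∧ ∀ ⦃u v⦄, H.Adj u v → G.Adj (f u) (f v)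

/-- The maximum degree of a graph on a finite vertex type. -/
noncomputable def maxDeg {V : Type*} [Fintype V] (G : SimpleGraph V) : ℕ :=
  Finset.univ.sup fun v => (G.neighborSet v).ncard

/-- The maximum 0-density `m₀(H)`. -/
noncomputable def m0 {V : Type*} [Fintype V] (H : SimpleGraph V) : ℝ :=
  sSup {x : ℝ | ∃ H' : H.Subgraph, H'.verts.Nonempty ∧
    x = (H'.edgeSet.ncard : ℝ) / (H'.verts.ncard : ℝ)}

/-- The maximum 1-density `m₁(H)`. -/
noncomputable def m1 {V : Type*} [Fintype V] (H : SimpleGraph V) : ℝ :=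
  sSup {x : ℝ | ∃ H' : H.Subgraph, 1 < H'.verts.ncard ∧
    x = (H'.edgeSet.ncard : ℝ) / ((H'.verts.ncard : ℝ) - 1)}

/-- The maximum 2-density `m₂(H)`. -/
noncomputable def m2 {V : Type*} [Fintype V] (H : SimpleGraph V) : ℝ :=
  sSup {x : ℝ | ∃ H' : H.Subgraph, 0 < H'.edgeSet.ncard ∧
    x = if 2 < H'.verts.ncard
      then ((H'.edgeSet.ncard : ℝ) - 1) / ((H'.verts.ncard : ℝ) - 2)
      else 1 / 2}

/-- The maximum Riordan-density `m_R(H)`. -/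
noncomputable def mR {V : Type*} [Fintype V] (H : SimpleGraph V) : ℝ :=
  sSup {x : ℝ | ∃ H' : H.Subgraph, 2 < H'.verts.ncard ∧
    x = (H'.edgeSet.ncard : ℝ) / ((H'.verts.ncard : ℝ) - 2)}

/-- The local 1-density `m₁(x,H)` of `H` at the vertex `x`. -/
noncomputable def m1At {V : Type*} [Fintype V] (H : SimpleGraph V) (x : V) : ℝ :=
  sSup {r : ℝ | ∃ H' : H.Subgraph, x ∈ H'.verts ∧ 1 < H'.verts.ncard ∧
    r = (H'.edgeSet.ncard : ℝ) / ((H'.verts.ncard : ℝ) - 1)}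

/-- `H` is strictly 1-balanced: `H` itself is the unique maximiser of the 1-density. -/
def StrictlyOneBalanced {V : Type*} [Fintype V] (H : SimpleGraph V) : Prop :=
  ∀ H' : H.Subgraph, 1 < H'.verts.ncard → H' ≠ ⊤ →
    (H'.edgeSet.ncard : ℝ) / ((H'.verts.ncard : ℝ) - 1) <
      (H.edgeSet.ncard : ℝ) / ((Fintype.card V : ℝ) - 1)

/-- `H` is vertex-1-balanced: the local 1-density at every vertex equals `m₁(H)`. -/
def VertexOneBalanced {V : Type*} [Fintype V] (H : SimpleGraph V) : Prop :=
  ∀ x : V, m1At H x = m1 H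

/-- `G` (an `n`-vertex graph) contains an `H`-factor: `⌊n / v(H)⌋` pairwise vertex-disjoint
copies of `H`. -/
def HasFactor {V : Type*} [Fintype V] (H : SimpleGraph V) {n : ℕ}
    (G : SimpleGraph (Fin n)) : Prop :=
  ∃ f : Fin (n / Fintype.card V) × V → Fin n, Function.Injective f ∧
    ∀ (i : Fin (n / Fintype.card V)) ⦃u v : V⦄, H.Adj u v → G.Adj (f (i, u)) (f (i, v))

namespace Rior
open Finset

lemma card_supersets {ι : Type*} [Fintype ι] [DecidableEq ι] (T : Finset ι) (M : ℕ)
    (h : T.card ≤ M) :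
    ((powersetCard M (univ : Finset ι)).filter (fun A => T ⊆ A)).card
      = (Fintype.card ι - T.card).choose (M - T.card) := by
  rw [← card_compl, ← card_powersetCard]
  refine card_nbij' (fun A => A \ T) (fun B => B ∪ T) ?_ ?_ ?_ ?_
  · intro A hA
    simp only [coe_filter, mem_powersetCard, Set.mem_ofPred_eq, subset_univ, true_and] at hA
    simp only [mem_coe, mem_powersetCard]
    refine ⟨?_, ?_⟩
    · intro x hx; simp at hx ⊢; exact hx.2
    · rw [card_sdiff_of_subset hA.2, hA.1]
  · intro B hB
    simp only [mem_coe, mem_powersetCard] at hB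
    simp only [coe_filter, mem_powersetCard, Set.mem_ofPred_eq, subset_univ, true_and]
    refine ⟨?_, subset_union_right⟩
    rw [card_union_of_disjoint, hB.2]; omega
    rw [disjoint_left]; intro x hx; simpa using hB.1 hx
  · intro A hA
    simp only [coe_filter, mem_powersetCard, Set.mem_ofPred_eq, subset_univ, true_and] at hA
    exact sdiff_union_of_subset hA.2
  · intro B hB
    simp only [mem_coe, mem_powersetCard] at hB
    refine union_sdiff_cancel_right ?_
    rw [disjoint_left]; intro x hx; simpa using hB.1 hx

lemma choose_step (N M k : ℕ) (h : k < M) (hMN : M ≤ N) :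
    ((N - (k+1)).choose (M - (k+1)) : ℝ) * ((N:ℝ) - k) = ((N - k).choose (M - k) : ℝ) * ((M:ℝ) - k) := by
  have h1 := Nat.add_one_mul_choose_eq (N - (k+1)) (M - (k+1))
  have e1 : (N - (k+1)) + 1 = N - k := by omega
  have e2 : (M - (k+1)) + 1 = M - k := by omega
  rw [e1, e2] at h1
  have h2 : ((N - k : ℕ) : ℝ) * ((N - (k+1)).choose (M - (k+1)) : ℝ)
     = ((N - k).choose (M - k) : ℝ) * ((M - k : ℕ) : ℝ) := by exact_mod_cast h1
  rw [Nat.cast_sub (by omega), Nat.cast_sub (by omega)] at h2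
  linarith

lemma choose_r (N M e : ℕ) (h : 2 * e < M) (hMN : M ≤ N) (r : ℕ) (hr : r ≤ 2 * e) :
    ((N - (2*e - r)).choose (M - (2*e - r)) : ℝ)
      ≤ (((N:ℝ) - 2*e)/((M:ℝ) - 2*e)) ^ r * ((N - 2*e).choose (M - 2*e) : ℝ) := by
  induction r with
  | zero => simp
  | succ r ih =>
    have ih := ih (by omega)
    have hs := choose_step N M (2*e - (r+1)) (by omega) hMN
    have e1 : 2*e - (r+1) + 1 = 2*e - r := by omega
    rw [e1] at hs
    set k := 2*e - (r+1) with hk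
    have hk2 : (k:ℝ) ≤ 2*e := by exact_mod_cast (by omega : k ≤ 2*e)
    have hM : (2*e : ℝ) < M := by exact_mod_cast h
    have hN : (M : ℝ) ≤ N := by exact_mod_cast hMN
    have : ((N - k).choose (M - k) : ℝ) = (((N:ℝ) - k)/((M:ℝ) - k)) * ((N - (2*e - r)).choose (M - (2*e - r)) : ℝ) := by
      have : (M:ℝ) - k ≠ 0 := by linarith
      field_simp
      linarith
    rw [this, pow_succ']
    rw [mul_assoc]
    apply mul_le_mul _ ih (by positivity) (by apply div_nonneg <;> linarith)
    rw [div_le_div_iff₀ (by linarith) (by linarith)]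
    nlinarith

lemma choose_e (N M e : ℕ) (h : 2 * e < M) (hMN : M ≤ N) (i : ℕ) (hi : i ≤ e) :
    ((N - (e+i)).choose (M - (e+i)) : ℝ) * (N.choose M : ℝ)
      ≤ (1 - (e:ℝ) * (N - M) / (N * M)) ^ i * ((N - e).choose (M - e) : ℝ)
        * ((N - i).choose (M - i) : ℝ) := by
  have hM : (2*e : ℝ) < M := by exact_mod_cast h
  have hN : (M : ℝ) ≤ N := by exact_mod_cast hMN
  have he : (0:ℝ) ≤ e := by positivity
  have hM0 : (0:ℝ) < M := by linarith
  have hy : 0 ≤ 1 - (e:ℝ) * (N - M) / (N * M) := by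
    rw [sub_nonneg, div_le_one (by nlinarith)]
    nlinarith
  induction i with
  | zero => simp
  | succ i ih =>
    have ih := ih (by omega)
    have h1 := choose_step N M (e+i) (by omega) hMN
    have h2 := choose_step N M i (by omega) hMN
    have hie : (i:ℝ) + 1 ≤ e := by exact_mod_cast hi
    rw [← add_assoc e i 1]
    push_cast at h1
    set a1 := ((N - (e+i+1)).choose (M - (e+i+1)) : ℝ)
    set a0 := ((N - (e+i)).choose (M - (e+i)) : ℝ)
    set b1 := ((N - (i+1)).choose (M - (i+1)) : ℝ)
    set b0 := ((N - i).choose (M - i) : ℝ)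
    set y := 1 - (e:ℝ) * (N - M) / (N * M) with hyd
    have hi0 : (0:ℝ) ≤ i := by positivity
    have ea : a1 = a0 * (((M:ℝ) - (e+i)) / (N - (e+i))) := by
      have : (N:ℝ) - (e+i) ≠ 0 := by linarith
      rw [mul_div_assoc', eq_div_iff this, h1]
    have eb : b1 = b0 * (((M:ℝ) - i) / (N - i)) := by
      have : (N:ℝ) - i ≠ 0 := by linarith
      rw [mul_div_assoc', eq_div_iff this, h2]
    have key : ((M:ℝ) - (e+i)) / (N - (e+i)) ≤ y * (((M:ℝ) - i) / (N - i)) := by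
      have e1 : ((M:ℝ) - (e+i)) / (N - (e+i))
          = (1 - (e:ℝ) * (N - M) / ((N - (e+i)) * (M - i))) * (((M:ℝ) - i) / (N - i)) := by
        have h3 : (N:ℝ) - (e+i) ≠ 0 := by linarith
        have h4 : (N:ℝ) - i ≠ 0 := by linarith
        have h5 : (M:ℝ) - i ≠ 0 := by linarith
        field_simp
        ring
      rw [e1]
      apply mul_le_mul_of_nonneg_right _ (by apply div_nonneg <;> linarith)
      rw [hyd]
      apply sub_le_sub_left
      apply div_le_div_of_nonneg_left
      · nlinarith
      · apply mul_pos <;> linarith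
      · apply mul_le_mul <;> linarith
    have hcc : (0:ℝ) ≤ (N.choose M : ℝ) := by positivity
    have ha0 : 0 ≤ a0 := by positivity
    have hx : 0 ≤ ((M:ℝ) - (e+i)) / (N - (e+i)) := by apply div_nonneg <;> linarith
    rw [ea, eb]
    calc a0 * (((M:ℝ) - (e+i)) / (N - (e+i))) * (N.choose M : ℝ)
        = (a0 * (N.choose M : ℝ)) * (((M:ℝ) - (e+i)) / (N - (e+i))) := by ring
      _ ≤ (y ^ i * ((N - e).choose (M - e) : ℝ) * b0) * (y * (((M:ℝ) - i) / (N - i))) := by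
          apply mul_le_mul ih key hx (by positivity)
      _ = _ := by ring

lemma choose_main (N M e : ℕ) (h : 2 * e < M) (hMN : M ≤ N) (r : ℕ) (hr : r ≤ e) :
    ((N - (2*e - r)).choose (M - (2*e - r)) : ℝ) * (N.choose M : ℝ)
      ≤ Real.exp (-((e:ℝ)^2 * (N - M) / (N * M))) * (((N:ℝ) - 2*e)/((M:ℝ) - 2*e)) ^ r
        * ((N - e).choose (M - e) : ℝ) ^ 2 := by
  have hM : (2*e : ℝ) < M := by exact_mod_cast h
  have hN : (M : ℝ) ≤ N := by exact_mod_cast hMN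
  have he : (0:ℝ) ≤ e := by positivity
  have hM0 : (0:ℝ) < M := by linarith
  have hy : 0 ≤ 1 - (e:ℝ) * (N - M) / (N * M) := by
    rw [sub_nonneg, div_le_one (by nlinarith)]
    nlinarith
  have h1 := choose_r N M e h hMN r (by omega)
  have h2 := choose_e N M e h hMN e le_rfl
  have h3 : (1 - (e:ℝ) * (N - M) / (N * M)) ^ e ≤ Real.exp (-((e:ℝ)^2 * (N - M) / (N * M))) := by
    have : (1 - (e:ℝ) * (N - M) / (N * M)) ≤ Real.exp (-((e:ℝ) * (N - M) / (N * M))) := by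
      have := Real.add_one_le_exp (-((e:ℝ) * (N - M) / (N * M))); linarith
    calc _ ≤ (Real.exp (-((e:ℝ) * (N - M) / (N * M)))) ^ e := pow_le_pow_left₀ hy this _
      _ = _ := by rw [← Real.exp_nat_mul]; congr 1; ring
  rw [← two_mul] at h2
  have hq : 0 ≤ ((N:ℝ) - 2*e)/((M:ℝ) - 2*e) := by apply div_nonneg <;> linarith
  calc ((N - (2*e - r)).choose (M - (2*e - r)) : ℝ) * (N.choose M : ℝ)
      ≤ ((((N:ℝ) - 2*e)/((M:ℝ) - 2*e)) ^ r * ((N - 2*e).choose (M - 2*e) : ℝ)) * (N.choose M : ℝ) := by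
        gcongr
    _ = (((N:ℝ) - 2*e)/((M:ℝ) - 2*e)) ^ r * (((N - 2*e).choose (M - 2*e) : ℝ) * (N.choose M : ℝ)) := by ring
    _ ≤ (((N:ℝ) - 2*e)/((M:ℝ) - 2*e)) ^ r * (Real.exp (-((e:ℝ)^2 * (N - M) / (N * M)))
          * ((N - e).choose (M - e) : ℝ) * ((N - e).choose (M - e) : ℝ)) := by
        refine mul_le_mul_of_nonneg_left (h2.trans ?_) (by positivity)
        gcongr
    _ = _ := by ring

/-- second moment on a slice -/
lemma slice_bound {ι P : Type*} [Fintype ι] [DecidableEq ι] [Fintype P] [Nonempty P]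
    (T : P → Finset ι) (e M : ℕ) (hT : ∀ π, (T π).card = e) (h : 2 * e < M)
    (hMN : M ≤ Fintype.card ι) (R : ℝ)
    (hR : Real.exp (-((e:ℝ)^2 * ((Fintype.card ι : ℝ) - M) / ((Fintype.card ι : ℝ) * M))) *
      ∑ π, ∑ π', (((Fintype.card ι:ℝ) - 2*e)/((M:ℝ) - 2*e)) ^ (T π ∩ T π').card
       ≤ R * (Fintype.card P : ℝ)^2) :
    (((powersetCard M (univ : Finset ι)).filter (fun A => ∀ π, ¬ T π ⊆ A)).card : ℝ)
      ≤ (R - 1) * ((Fintype.card ι).choose M : ℝ) := by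
  classical
  set N := Fintype.card ι with hN
  set S := powersetCard M (univ : Finset ι) with hS
  set X : Finset ι → ℝ := fun A => ∑ π, if T π ⊆ A then (1:ℝ) else 0 with hX
  set C : ℝ := (N.choose M : ℝ) with hC
  set a : ℝ := ((N - e).choose (M - e) : ℝ) with ha
  have hCpos : 0 < C := by rw [hC]; exact_mod_cast Nat.choose_pos hMN
  have hapos : 0 < a := by rw [ha]; exact_mod_cast Nat.choose_pos (by omega)
  have hPpos : (0:ℝ) < Fintype.card P := by exact_mod_cast Fintype.card_pos
  have h1 : ∑ A ∈ S, X A = Fintype.card P * a := by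
    rw [hX, sum_comm]
    have : ∀ π, (∑ A ∈ S, if T π ⊆ A then (1:ℝ) else 0) = a := by
      intro π
      rw [← sum_filter, sum_const, nsmul_eq_mul, mul_one, card_supersets _ _ (by rw [hT]; omega), hT]
    simp [this]
  have h2 : C * ∑ A ∈ S, X A ^ 2 ≤ R * (Fintype.card P)^2 * a^2 := by
    have e1 : ∑ A ∈ S, X A ^ 2 = ∑ π, ∑ π', ((N - (2*e - (T π ∩ T π').card)).choose (M - (2*e - (T π ∩ T π').card)) : ℝ) := by
      have : ∀ A ∈ S, X A ^ 2 = ∑ π, ∑ π', if T π ∪ T π' ⊆ A then (1:ℝ) else 0 := by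
        intro A _
        rw [hX, sq, sum_mul_sum]
        refine sum_congr rfl fun π _ => sum_congr rfl fun π' _ => ?_
        by_cases h1 : T π ⊆ A <;> by_cases h2 : T π' ⊆ A <;> simp [union_subset_iff, h1, h2]
      rw [sum_congr rfl this, sum_comm]
      refine sum_congr rfl fun π _ => ?_
      rw [sum_comm]
      refine sum_congr rfl fun π' _ => ?_
      have hc : (T π ∪ T π').card = 2*e - (T π ∩ T π').card := by
        have := card_union_add_card_inter (T π) (T π')
        rw [hT, hT] at this; omega
      rw [← sum_filter, sum_const, nsmul_eq_mul, mul_one, card_supersets _ _ (by omega), hc]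
    rw [e1, mul_sum]
    calc _ ≤ ∑ π, ∑ π', Real.exp (-((e:ℝ)^2 * (N - M) / (N * M))) * (((N:ℝ) - 2*e)/((M:ℝ) - 2*e)) ^ ((T π ∩ T π').card) * a^2 := by
          refine sum_le_sum fun π _ => ?_
          rw [mul_sum]
          refine sum_le_sum fun π' _ => ?_
          rw [mul_comm]
          exact choose_main N M e h hMN _ ((card_le_card inter_subset_left).trans (hT π).le)
      _ = (Real.exp (-((e:ℝ)^2 * (N - M) / (N * M))) *
      ∑ π, ∑ π', (((N:ℝ) - 2*e)/((M:ℝ) - 2*e)) ^ (T π ∩ T π').card) * a^2 := by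
          rw [mul_sum, sum_mul]
          refine sum_congr rfl fun π _ => ?_
          rw [mul_sum, sum_mul]
      _ ≤ _ := by gcongr
  set B := S.filter (fun A => ∀ π, ¬ T π ⊆ A) with hB
  set G := S.filter (fun A => ¬ ∀ π, ¬ T π ⊆ A) with hG
  have hBG : (B.card : ℝ) + G.card = C := by
    rw [hC]
    have := card_filter_add_card_filter_not (s := S) (fun A => ∀ π, ¬ T π ⊆ A)
    rw [hS, card_powersetCard, card_univ] at this
    exact_mod_cast this
  have h3 : ∑ A ∈ S, X A = ∑ A ∈ G, X A := by
    rw [hG, sum_filter_of_ne]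
    intro A _ hne hcon
    apply hne
    exact sum_eq_zero fun π _ => if_neg (hcon π)
  have h4 := sq_sum_le_card_mul_sum_sq (s := G) (f := X)
  have h5 : ∑ A ∈ G, X A ^ 2 ≤ ∑ A ∈ S, X A ^ 2 :=
    sum_le_sum_of_subset_of_nonneg (filter_subset _ _) (fun _ _ _ => sq_nonneg _)
  rw [← h3, h1] at h4
  -- C P² a² ≤ |G| R P² a²
  have h6 : C ≤ G.card * R := by
    have h7 : C * (Fintype.card P * a)^2 ≤ (G.card * R) * (Fintype.card P * a)^2 := by
      calc C * (Fintype.card P * a)^2 ≤ C * (G.card * ∑ A ∈ G, X A ^ 2) := by gcongr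
        _ ≤ C * (G.card * ∑ A ∈ S, X A ^ 2) := by gcongr
        _ = G.card * (C * ∑ A ∈ S, X A ^ 2) := by ring
        _ ≤ G.card * (R * (Fintype.card P)^2 * a^2) := by gcongr
        _ = _ := by ring
    exact le_of_mul_le_mul_right h7 (by positivity)
  have hB0 : (0:ℝ) ≤ B.card := by positivity
  have hG0 : (0:ℝ) ≤ G.card := by positivity
  have hRpos : 0 < R := by
    by_contra hcon
    nlinarith
  have hR1 : 1 ≤ R := by nlinarith
  -- B = C - G ≤ (R-1) C
  nlinarith

/-- transfer from slice to product measure -/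
lemma product_bound {ι : Type*} [Fintype ι] [DecidableEq ι] (Bad : Finset ι → Prop)
    [DecidablePred Bad] (hmono : ∀ A B, A ⊆ B → Bad B → Bad A) (p : ℝ) (hp0 : 0 ≤ p) (hp1 : p ≤ 1)
    (M : ℕ) (ε d : ℝ) (hd : 0 < d) (hM : ∀ k : ℕ, k < M → (k:ℝ) ≤ Fintype.card ι * p - d)
    (hε : (((powersetCard M (univ : Finset ι)).filter Bad).card : ℝ)
      ≤ ε * ((Fintype.card ι).choose M : ℝ)) (hMN : M ≤ Fintype.card ι) :
    ∑ A ∈ (univ : Finset (Finset ι)).filter Bad, p ^ A.card * (1 - p) ^ (Fintype.card ι - A.card)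
      ≤ ε + Fintype.card ι / d ^ 2 := by
  set N := Fintype.card ι with hN
  set b : ℕ → ℝ := fun k => (((powersetCard k (univ : Finset ι)).filter Bad).card : ℝ) / (N.choose k) with hb
  have hsucc : ∀ k, b (k+1) ≤ b k := by
    intro k
    set 𝒜 := (powersetCard (k+1) (univ : Finset ι)).filter Bad with h𝒜
    have hsz : (𝒜 : Set (Finset ι)).Sized (k+1) := by
      intro A hA
      simp only [h𝒜, coe_filter, mem_powersetCard, Set.mem_ofPred_eq] at hA
      exact hA.1.2
    have := local_lubell_yamamoto_meshalkin_inequality_div (𝕜 := ℝ) (by omega) hsz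
    refine this.trans ?_
    simp only [Nat.add_sub_cancel]
    apply div_le_div_of_nonneg_right _ (by positivity)
    have hsub : 𝒜.shadow ⊆ (powersetCard k (univ : Finset ι)).filter Bad := by
      intro B hB
      rw [mem_shadow_iff] at hB
      obtain ⟨A, hA, a, ha, rfl⟩ := hB
      simp only [h𝒜, mem_filter, mem_powersetCard, subset_univ, true_and] at hA ⊢
      refine ⟨by rw [card_erase_of_mem ha, hA.1]; simp, hmono _ _ (erase_subset _ _) hA.2⟩
    exact_mod_cast card_le_card hsub
  have hanti : Antitone b := antitone_nat_of_succ_le hsucc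
  have hb1 : ∀ k, b k ≤ 1 := by
    intro k
    apply div_le_one_of_le₀ _ (by positivity)
    have := card_filter_le (powersetCard k (univ : Finset ι)) Bad
    rw [card_powersetCard, card_univ] at this
    exact_mod_cast this
  have hb0 : ∀ k, 0 ≤ b k := fun k => by positivity
  have hbM : b M ≤ ε := by
    rw [hb]; simp only
    rw [div_le_iff₀ (by exact_mod_cast Nat.choose_pos hMN)]
    exact hε
  have hε0 : 0 ≤ ε := (hb0 M).trans hbM
  set w : ℕ → ℝ := fun k => (N.choose k : ℝ) * p ^ k * (1 - p) ^ (N - k) with hw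
  have hw0 : ∀ k, 0 ≤ w k := fun k => by
    have : 0 ≤ 1 - p := by linarith
    positivity
  have hwsum : ∑ k ∈ range (N+1), w k = 1 := by
    have := bernsteinPolynomial.sum ℝ N
    apply_fun fun q => Polynomial.eval p q at this
    simpa [bernsteinPolynomial, Polynomial.eval_finsetSum, hw] using this
  have hwvar : ∑ k ∈ range (N+1), ((N:ℝ) * p - k)^2 * w k = N * p * (1 - p) := by
    have := bernsteinPolynomial.variance ℝ N
    apply_fun fun q => Polynomial.eval p q at this
    simpa [bernsteinPolynomial, Polynomial.eval_finsetSum, hw] using this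
  have hsum : ∑ A ∈ (univ : Finset (Finset ι)).filter Bad, p ^ A.card * (1 - p) ^ (N - A.card)
      = ∑ k ∈ range (N+1), b k * w k := by
    rw [sum_filter, ← powerset_univ, sum_powerset, card_univ, ← hN]
    refine sum_congr rfl fun k hk => ?_
    have hk : k ≤ N := by simp at hk; omega
    have hch : (N.choose k : ℝ) ≠ 0 := by exact_mod_cast (Nat.choose_pos hk).ne'
    rw [← sum_filter]
    rw [sum_congr rfl (g := fun _ => p ^ k * (1 - p) ^ (N - k))]
    · rw [sum_const, nsmul_eq_mul, hb, hw]
      field_simp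
    · intro A hA
      simp only [mem_filter, mem_powersetCard] at hA
      rw [hA.1.2]
  rw [hsum]
  calc ∑ k ∈ range (N+1), b k * w k ≤ ∑ k ∈ range (N+1), (ε * w k + (((N:ℝ) * p - k)^2 * w k) / d^2) := by
        refine sum_le_sum fun k _ => ?_
        have hpos : 0 ≤ (((N:ℝ) * p - k)^2 * w k) / d^2 := by have := hw0 k; positivity
        by_cases hk : k < M
        · have h1 := hM k hk
          have h2 : d^2 ≤ ((N:ℝ) * p - k)^2 := by apply pow_le_pow_left₀ hd.le; linarith
          have h3 : w k ≤ (((N:ℝ) * p - k)^2 * w k) / d^2 := by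
            rw [le_div_iff₀ (by positivity), mul_comm]
            exact mul_le_mul_of_nonneg_right h2 (hw0 k)
          have h4 : b k * w k ≤ 1 * w k := mul_le_mul_of_nonneg_right (hb1 k) (hw0 k)
          have h5 : 0 ≤ ε * w k := mul_nonneg hε0 (hw0 k)
          linarith
        · have h1 : b k ≤ ε := (hanti (not_lt.mp hk)).trans hbM
          have h4 : b k * w k ≤ ε * w k := mul_le_mul_of_nonneg_right h1 (hw0 k)
          linarith
    _ = ε + N * p * (1 - p) / d^2 := by
        rw [sum_add_distrib, ← mul_sum, hwsum, ← sum_div, hwvar, mul_one]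
    _ ≤ _ := by
        gcongr
        have : (0:ℝ) ≤ N := by positivity
        have : p * (1 - p) ≤ 1 := by nlinarith
        nlinarith

end Rior

namespace Rior
open Finset

section comb
variable {V : Type*} [Fintype V] [DecidableEq V]

/-- vertices covered by an edge set -/
def vs (F : Finset (Sym2 V)) : Finset V := univ.filter (fun x => ∃ e ∈ F, x ∈ e)

/-- `f` maps all edges of `F` into `E` -/
def pres (E F : Finset (Sym2 V)) (f : V → V) : Prop := ∀ e ∈ F, Sym2.map f e ∈ E

instance (E F : Finset (Sym2 V)) : DecidablePred (pres E F) := fun _ => by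
  unfold pres; infer_instance

/-- number of maps sending `F` into `E` -/
def hc (E F : Finset (Sym2 V)) : ℕ := (univ.filter (fun f : V → V => pres E F f)).card

/-- homomorphism density -/
noncomputable def td (E F : Finset (Sym2 V)) : ℝ :=
  (hc E F : ℝ) / (Fintype.card V : ℝ) ^ (Fintype.card V)

lemma mem_vs {F : Finset (Sym2 V)} {x : V} : x ∈ vs F ↔ ∃ e ∈ F, x ∈ e := by simp [vs]

lemma pres_congr {E F : Finset (Sym2 V)} {f g : V → V} (h : ∀ x ∈ vs F, f x = g x)
    (hf : pres E F f) : pres E F g := by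
  intro e he
  have := hf e he
  rwa [Sym2.map_congr (g := g)] at this
  intro x hx
  exact h x (mem_vs.2 ⟨e, he, hx⟩)

lemma td_nonneg (E F : Finset (Sym2 V)) : 0 ≤ td E F := by unfold td; positivity

lemma nn_pos {V : Type*} [Fintype V] : (0:ℝ) < (Fintype.card V : ℝ) ^ (Fintype.card V) := by
  rcases Nat.eq_zero_or_pos (Fintype.card V) with h | h
  · rw [h]; simp
  · positivity

lemma td_anti {E F F' : Finset (Sym2 V)} (h : F ⊆ F') : td E F' ≤ td E F := by
  unfold td
  apply div_le_div_of_nonneg_right _ nn_pos.le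
  unfold hc
  exact_mod_cast card_le_card (fun f hf => by
    simp only [mem_filter, mem_univ, true_and] at hf ⊢
    exact fun e he => hf e (h he))

lemma td_empty (E : Finset (Sym2 V)) : td E ∅ = 1 := by
  unfold td hc
  have : (univ.filter (fun f : V → V => pres E ∅ f)) = univ := by
    ext f; simp [pres]
  rw [this, card_univ, Fintype.card_fun]
  push_cast
  exact div_self nn_pos.ne'

lemma td_union {E F G : Finset (Sym2 V)} (h : Disjoint (vs F) (vs G)) :
    td E (F ∪ G) = td E F * td E G := by
  have key : hc E (F ∪ G) * (Fintype.card V) ^ (Fintype.card V) = hc E F * hc E G := by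
    unfold hc
    rw [← Fintype.card_fun, ← card_univ, ← card_product, ← card_product]
    refine card_nbij' (fun q => ((vs F).piecewise q.1 q.2, (vs F).piecewise q.2 q.1))
      (fun q => ((vs F).piecewise q.1 q.2, (vs F).piecewise q.2 q.1)) ?_ ?_ ?_ ?_
    · rintro ⟨f, g⟩ hfg
      simp only [coe_product, coe_filter, mem_univ, true_and, Set.mem_prod, Set.mem_ofPred_eq,
        coe_univ, Set.mem_univ, and_true] at hfg ⊢
      constructor
      · refine pres_congr (f := f) ?_ (fun e he => hfg e (mem_union_left _ he))
        intro x hx; simp [hx]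
      · refine pres_congr (f := f) ?_ (fun e he => hfg e (mem_union_right _ he))
        intro x hx
        have : x ∉ vs F := fun h' => disjoint_left.1 h h' hx
        simp [this]
    · rintro ⟨f, g⟩ hfg
      simp only [coe_product, coe_filter, mem_univ, true_and, Set.mem_prod, Set.mem_ofPred_eq,
        coe_univ, Set.mem_univ, and_true] at hfg ⊢
      intro e he
      rcases mem_union.1 he with he | he
      · refine pres_congr (f := f) ?_ hfg.1 e he
        intro x hx; simp [hx]
      · refine pres_congr (f := g) ?_ hfg.2 e he
        intro x hx
        have : x ∉ vs F := fun h' => disjoint_left.1 h h' hx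
        simp [this]
    · rintro ⟨f, g⟩ _
      ext x <;> by_cases hx : x ∈ vs F <;> simp [hx]
    · rintro ⟨f, g⟩ _
      ext x <;> by_cases hx : x ∈ vs F <;> simp [hx]
  unfold td
  have hp := nn_pos (V := V)
  rw [div_mul_div_comm, div_eq_div_iff hp.ne' (by positivity)]
  have : (hc E (F ∪ G) : ℝ) * (Fintype.card V : ℝ) ^ (Fintype.card V) = hc E F * hc E G := by
    exact_mod_cast key
  rw [← this]; ring

lemma pow_fact_bound (n v : ℕ) (hv : v ≤ n) :
    (n:ℝ) ^ v * ((n - v).factorial : ℝ) ≤ (n.factorial : ℝ) * Real.exp (4 * (v:ℝ)^2 / n) := by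
  rcases Nat.eq_zero_or_pos n with h0 | h0
  · subst h0
    have : v = 0 := by omega
    subst this; simp
  have hn : (0:ℝ) < n := by exact_mod_cast h0
  by_cases h2 : 2 * v ≤ n
  · induction v with
    | zero => simp
    | succ v ih =>
      have ih := ih (by omega) (by omega)
      have hf : ((n - v).factorial : ℝ) = ((n:ℝ) - v) * ((n - (v+1)).factorial : ℝ) := by
        have : n - v = (n - (v+1)) + 1 := by omega
        rw [this, Nat.factorial_succ]
        push_cast
        rw [Nat.cast_sub (by omega)]
        push_cast; ring
      have hvn : 2 * ((v:ℝ) + 1) ≤ n := by exact_mod_cast h2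
      have hv0 : (0:ℝ) ≤ v := by positivity
      have hstep : (n:ℝ) ≤ Real.exp (2 * v / n) * (n - v) := by
        have h1 := Real.add_one_le_exp (2 * (v:ℝ) / n)
        have h3 : (n:ℝ) ≤ (2 * (v:ℝ) / n + 1) * (n - v) := by
          have : (2 * (v:ℝ) / n + 1) * (n - v) = n + v * (n - 2 * v) / n := by field_simp; ring
          rw [this]
          have : 0 ≤ (v:ℝ) * (n - 2 * v) / n := by
            apply div_nonneg _ hn.le
            apply mul_nonneg hv0; linarith
          linarith
        refine h3.trans ?_
        apply mul_le_mul_of_nonneg_right h1; linarith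
      have hexp : Real.exp (4 * (v:ℝ)^2 / n) * Real.exp (2 * v / n) ≤ Real.exp (4 * ((v+1 : ℕ):ℝ)^2 / n) := by
        rw [← Real.exp_add]
        apply Real.exp_le_exp.2
        rw [← add_div]
        apply div_le_div_of_nonneg_right _ hn.le
        push_cast; nlinarith
      calc (n:ℝ) ^ (v+1) * ((n - (v+1)).factorial : ℝ)
          = (n:ℝ)^v * ((n - (v+1)).factorial : ℝ) * n := by ring
        _ ≤ (n:ℝ)^v * ((n - (v+1)).factorial : ℝ) * (Real.exp (2 * v / n) * (n - v)) := by gcongr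
        _ = ((n:ℝ)^v * ((n - v).factorial : ℝ)) * Real.exp (2 * v / n) := by rw [hf]; ring
        _ ≤ ((n.factorial : ℝ) * Real.exp (4 * (v:ℝ)^2 / n)) * Real.exp (2 * v / n) := by gcongr
        _ = (n.factorial : ℝ) * (Real.exp (4 * (v:ℝ)^2 / n) * Real.exp (2 * v / n)) := by ring
        _ ≤ _ := by gcongr
  · have h1 : (n:ℝ) ^ v * ((n - v).factorial : ℝ) ≤ (n:ℝ)^n := by
      have : ((n - v).factorial : ℝ) ≤ (n:ℝ)^(n-v) := by
        have h3 : (n - v).factorial ≤ (n-v)^(n-v) := Nat.factorial_le_pow _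
        have h4 : (n-v)^(n-v) ≤ n^(n-v) := Nat.pow_le_pow_left (by omega) _
        exact_mod_cast h3.trans h4
      calc (n:ℝ) ^ v * ((n - v).factorial : ℝ) ≤ (n:ℝ)^v * (n:ℝ)^(n-v) := by gcongr
        _ = _ := by rw [← pow_add]; congr 1; omega
    have h2' := Real.pow_div_factorial_le_exp (n:ℝ) hn.le n
    rw [div_le_iff₀ (by positivity)] at h2'
    have h3 : Real.exp n ≤ Real.exp (4 * (v:ℝ)^2 / n) := by
      apply Real.exp_le_exp.2
      rw [le_div_iff₀ hn]
      have : (n:ℝ) ≤ 2 * v := by exact_mod_cast (by omega : n ≤ 2 * v)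
      nlinarith
    calc _ ≤ _ := h1
      _ ≤ _ := h2'
      _ ≤ _ := by rw [mul_comm]; gcongr

lemma perm_fix_card (W : Finset V) :
    (univ.filter (fun τ : Equiv.Perm V => ∀ x ∈ W, τ x = x)).card = (Fintype.card V - W.card).factorial := by
  have h := Fintype.card_congr (Equiv.Perm.subtypeEquivSubtypePerm (fun x : V => x ∉ W))
  rw [Fintype.card_perm] at h
  have e1 : Fintype.card {x // x ∉ W} = Fintype.card V - W.card := by
    rw [Fintype.card_subtype]
    rw [← card_compl]; congr 1; ext x; simp
  rw [e1] at h
  rw [h, Fintype.card_subtype]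
  congr 1
  ext τ
  simp

lemma perm_bound (E F : Finset (Sym2 V)) :
    ((univ.filter (fun σ : Equiv.Perm V => pres E F σ)).card : ℝ)
      ≤ (Fintype.card V).factorial * (Real.exp (4 * ((vs F).card : ℝ)^2 / Fintype.card V) * td E F) := by
  set n := Fintype.card V with hn
  set W := vs F with hW
  set v := W.card with hv
  have hvn : v ≤ n := card_le_univ _
  set r : (V → V) → (V → V) := fun f => W.piecewise f id with hr
  set G := (univ.filter (fun f : V → V => pres E F f)).image r with hG
  have hreq : ∀ f g : V → V, r f = r g → ∀ x ∈ W, f x = g x := by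
    intro f g h x hx
    have := congrFun h x
    simpa [hr, hx] using this
  -- permutations
  have h1 : (univ.filter (fun σ : Equiv.Perm V => pres E F σ)).card ≤ (n - v).factorial * G.card := by
    have hsub : ((univ.filter (fun σ : Equiv.Perm V => pres E F σ)).image (fun σ : Equiv.Perm V => r σ)) ⊆ G := by
      intro g hg
      simp only [mem_image, mem_filter, mem_univ, true_and, hG] at hg ⊢
      obtain ⟨σ, hσ, rfl⟩ := hg
      exact ⟨σ, hσ, rfl⟩
    refine (card_le_mul_card_image (f := fun σ : Equiv.Perm V => r σ) _ ((n-v).factorial) ?_).trans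
      (Nat.mul_le_mul_left _ (card_le_card hsub))
    intro g hg
    simp only [mem_image, mem_filter, mem_univ, true_and] at hg
    obtain ⟨σ₀, hσ₀, rfl⟩ := hg
    rw [← perm_fix_card W]
    refine card_le_card_of_injOn (fun σ => σ₀⁻¹ * σ) ?_ ?_
    · intro σ hσ
      simp only [coe_filter, mem_filter, mem_univ, true_and, Set.mem_ofPred_eq] at hσ ⊢
      intro x hx
      have := hreq _ _ hσ.2 x hx
      simp [Equiv.Perm.mul_apply, this]
    · intro σ _ τ _ h
      simpa using h
  have h2 : n ^ (n - v) * G.card ≤ hc E F := by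
    refine mul_card_image_le_card _ _ ?_
    intro g hg
    simp only [mem_image, mem_filter, mem_univ, true_and] at hg
    obtain ⟨f₀, hf₀, rfl⟩ := hg
    have e1 : Fintype.card {x // x ∉ W} = n - v := by
      rw [Fintype.card_subtype]
      rw [hn, hv, ← card_compl]; congr 1; ext x; simp
    have e2 : n ^ (n - v) = (univ : Finset ({x // x ∉ W} → V)).card := by
      rw [card_univ, Fintype.card_fun, e1]
    rw [e2]
    refine card_le_card_of_injOn (fun h x => if hx : x ∈ W then f₀ x else h ⟨x, hx⟩) ?_ ?_
    · intro h _
      simp only [coe_filter, mem_filter, mem_univ, true_and, Set.mem_ofPred_eq]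
      constructor
      · refine pres_congr (f := f₀) ?_ hf₀
        intro x hx
        have hx : x ∈ W := hx
        simp [hx]
      · ext x
        by_cases hx : x ∈ W <;> simp [hr, hx]
    · intro h _ h' _ hh
      ext ⟨x, hx⟩
      have := congrFun hh x
      simpa [hx] using this
  have hnum := pow_fact_bound n v hvn
  have hnn := nn_pos (V := V)
  rw [← hn] at hnn
  have h1' : ((univ.filter (fun σ : Equiv.Perm V => pres E F σ)).card : ℝ) ≤ (n - v).factorial * G.card := by
    exact_mod_cast h1
  have h2' : (n:ℝ) ^ (n - v) * G.card ≤ hc E F := by exact_mod_cast h2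
  refine h1'.trans ?_
  unfold td
  rw [← hn, ← mul_assoc, mul_div_assoc', le_div_iff₀ hnn]
  have e3 : (n:ℝ)^n = n^v * n^(n-v) := by rw [← pow_add]; congr 1; omega
  calc ((n - v).factorial : ℝ) * G.card * (n:ℝ)^n
      = ((n:ℝ)^v * (n - v).factorial) * (n^(n-v) * G.card) := by rw [e3]; ring
    _ ≤ _ := by gcongr

/-- adding a pendant edge -/
lemma td_pendant {E F : Finset (Sym2 V)} {x y : V} {D : ℕ} (hxy : x ≠ y) (hy : y ∉ vs F)
    (hdeg : ∀ a : V, (univ.filter (fun b => s(a, b) ∈ E)).card ≤ D) :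
    td E (insert s(x, y) F) ≤ (D / Fintype.card V : ℝ) * td E F := by
  have key : hc E (insert s(x, y) F) * Fintype.card V ≤ hc E F * D := by
    have h1 : hc E (insert s(x, y) F) * Fintype.card V ≤
        ((univ.filter (fun f : V → V => pres E F f)).sigma
          (fun f => univ.filter (fun z => s(f x, z) ∈ E))).card := by
      unfold hc
      rw [← card_univ (α := V), ← card_product]
      refine card_le_card_of_injOn (fun q => ⟨Function.update q.1 y q.2, q.1 y⟩) ?_ ?_
      · rintro ⟨f, z⟩ hf
        simp only [coe_product, coe_filter, mem_univ, true_and, Set.mem_prod, Set.mem_ofPred_eq,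
          coe_univ, Set.mem_univ, and_true] at hf
        simp only [mem_coe, mem_sigma, mem_filter, mem_univ, true_and]
        constructor
        · refine pres_congr (f := f) ?_ (fun e he => hf e (mem_insert_of_mem he))
          intro w hw
          have : w ≠ y := fun h => hy (h ▸ hw)
          simp [this]
        · have := hf _ (mem_insert_self _ _)
          simpa [hxy] using this
      · rintro ⟨f, z⟩ _ ⟨g, w⟩ _ h
        simp only [Sigma.mk.injEq] at h
        obtain ⟨h1, h2⟩ := h
        have h2 := eq_of_heq h2
        have hz : z = w := by have := congrFun h1 y; simpa using this
        subst hz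
        congr 1
        ext a
        by_cases ha : a = y
        · subst ha; exact h2
        · have := congrFun h1 a; simpa [ha] using this
    refine h1.trans ?_
    rw [card_sigma]
    unfold hc
    rw [← smul_eq_mul, ← sum_const]
    exact sum_le_sum fun f _ => hdeg (f x)
  have hV : (0:ℝ) < Fintype.card V := by
    exact_mod_cast Fintype.card_pos_iff.2 ⟨x⟩
  unfold td
  rw [div_mul_div_comm, div_le_div_iff₀ nn_pos (mul_pos hV nn_pos)]
  have key' : (hc E (insert s(x, y) F) : ℝ) * Fintype.card V ≤ hc E F * D := by exact_mod_cast key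
  have hp := nn_pos (V := V)
  nlinarith

lemma td_single {E : Finset (Sym2 V)} {x y : V} (hxy : x ≠ y) (m : ℕ)
    (h2 : (univ.filter (fun q : V × V => s(q.1, q.2) ∈ E)).card ≤ 2 * m) :
    td E {s(x, y)} ≤ 2 * m / (Fintype.card V : ℝ)^2 := by
  have key : hc E {s(x, y)} * (Fintype.card V)^2 ≤ (Fintype.card V)^(Fintype.card V) * (2 * m) := by
    unfold hc
    have : (Fintype.card V)^2 = (univ : Finset (V × V)).card := by
      rw [card_univ, Fintype.card_prod, sq]
    rw [this, ← card_product]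
    refine le_trans ?_ (Nat.mul_le_mul_left _ h2)
    rw [← Fintype.card_fun, ← card_univ, ← card_product]
    refine card_le_card_of_injOn (fun q => (Function.update (Function.update q.1 x q.2.1) y q.2.2, (q.1 x, q.1 y))) ?_ ?_
    · rintro ⟨f, a, b⟩ hf
      simp only [coe_product, coe_filter, mem_univ, true_and, Set.mem_prod, Set.mem_ofPred_eq,
          coe_univ, Set.mem_univ, and_true] at hf ⊢
      have := hf _ (mem_singleton_self _)
      simpa using this
    · rintro ⟨f, a, b⟩ _ ⟨g, c, d⟩ _ h
      simp only [Prod.mk.injEq] at h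
      obtain ⟨h1, h2, h3⟩ := h
      have e1 : b = d := by have := congrFun h1 y; simpa using this
      have e2 : a = c := by have := congrFun h1 x; simpa [hxy] using this
      subst e1; subst e2
      congr 1
      ext w
      by_cases hw : w = y
      · subst hw; exact h3
      · by_cases hw' : w = x
        · subst hw'; exact h2
        · have := congrFun h1 w; simpa [hw, hw'] using this
  have hV : (0:ℝ) < Fintype.card V := by
    exact_mod_cast Fintype.card_pos_iff.2 ⟨x⟩
  unfold td
  rw [div_le_div_iff₀ nn_pos (by positivity)]
  rw [mul_comm (2 * (m:ℝ))]
  exact_mod_cast key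

end comb
end Rior

namespace Rior
open Finset

section comb2
variable {V : Type*} [Fintype V] [DecidableEq V]

lemma vs_union (F G : Finset (Sym2 V)) : vs (F ∪ G) = vs F ∪ vs G := by
  ext x; simp only [mem_vs, mem_union]
  constructor
  · rintro ⟨e, he | he, hx⟩
    · exact Or.inl ⟨e, he, hx⟩
    · exact Or.inr ⟨e, he, hx⟩
  · rintro (⟨e, he, hx⟩ | ⟨e, he, hx⟩)
    · exact ⟨e, Or.inl he, hx⟩
    · exact ⟨e, Or.inr he, hx⟩

/-- pairwise vertex-disjoint edges -/
def Matched (M : Finset (Sym2 V)) : Prop := ∀ e ∈ M, ∀ e' ∈ M, e' ≠ e → ∀ x ∈ e, x ∉ e'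

lemma matching_bounds {E : Finset (Sym2 V)} (m : ℕ)
    (h2 : (univ.filter (fun q : V × V => s(q.1, q.2) ∈ E)).card ≤ 2 * m)
    (M : Finset (Sym2 V)) (hd : ∀ e ∈ M, ¬ e.IsDiag) (hM : Matched M) :
    td E M ≤ (2 * m / (Fintype.card V : ℝ)^2) ^ M.card ∧ (vs M).card = 2 * M.card := by
  induction M using Finset.induction_on with
  | empty => simp [td_empty, vs]
  | insert e M he ih =>
    obtain ⟨ih1, ih2⟩ := ih (fun e' h => hd e' (mem_insert_of_mem h))
      (fun a ha b hb => hM a (mem_insert_of_mem ha) b (mem_insert_of_mem hb))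
    have hdis : Disjoint (vs {e}) (vs M) := by
      rw [disjoint_left]
      intro x hx hx'
      obtain ⟨e1, h1, h1x⟩ := mem_vs.1 hx
      obtain ⟨e2, h2, h2x⟩ := mem_vs.1 hx'
      rw [mem_singleton] at h1; subst h1
      exact hM e1 (mem_insert_self _ _) e2 (mem_insert_of_mem h2) (fun h => he (h ▸ h2)) x h1x h2x
    have hnd := hd e (mem_insert_self _ _)
    have hcard : (vs {e}).card = 2 := by
      have : vs {e} = e.toFinset := by ext x; simp [mem_vs]
      rw [this, Sym2.card_toFinset_of_not_isDiag e hnd]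
    rw [insert_eq, td_union hdis, vs_union, card_union_of_disjoint hdis, hcard, ih2, ← insert_eq,
      card_insert_of_notMem he, pow_succ']
    refine ⟨?_, by ring⟩
    have : td E {e} ≤ 2 * m / (Fintype.card V : ℝ)^2 := by
      induction e using Sym2.ind with
      | _ x y => exact td_single (by simpa using hnd) m h2
    exact mul_le_mul this ih1 (td_nonneg _ _) (by positivity)

/-- `R` connects `U` starting from `v` -/
def Conn (R : Finset (Sym2 V)) (v : V) (U : Finset V) : Prop :=
  v ∈ U ∧ ∀ A, A ⊆ U → v ∈ A → A ≠ U → ∃ x ∈ A, ∃ y ∈ U \ A, s(x, y) ∈ R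

lemma Conn.mono {R R' : Finset (Sym2 V)} {v : V} {U : Finset V} (h : R ⊆ R') (hc : Conn R v U) :
    Conn R' v U := by
  refine ⟨hc.1, fun A hA hv hne => ?_⟩
  obtain ⟨x, hx, y, hy, hxy⟩ := hc.2 A hA hv hne
  exact ⟨x, hx, y, hy, h hxy⟩

lemma td_conn {E R : Finset (Sym2 V)} {v : V} {U : Finset V} {D : ℕ} (hc : Conn R v U)
    (hdeg : ∀ a : V, (univ.filter (fun b => s(a, b) ∈ E)).card ≤ D) :
    td E R ≤ (D / Fintype.card V : ℝ) ^ (U.card - 1) := by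
  have key : ∀ k : ℕ, ∀ A, A ⊆ U → v ∈ A → (U \ A).card = k →
      td E R ≤ (D / Fintype.card V : ℝ) ^ k * td E (R.filter (fun e => ∀ x ∈ e, x ∈ A)) := by
    intro k
    induction k with
    | zero =>
      intro A _ _ _
      rw [pow_zero, one_mul]
      exact td_anti (filter_subset _ _)
    | succ k ih =>
      intro A hA hv hk
      have hne : A ≠ U := by rintro rfl; simp at hk
      obtain ⟨x, hx, y, hy, hxy⟩ := hc.2 A hA hv hne
      rw [Finset.mem_sdiff] at hy
      have h1 := ih (insert y A) (insert_subset hy.1 hA) (mem_insert_of_mem hv) (by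
        rw [sdiff_insert, card_erase_of_mem (by simp [hy]), hk]; simp)
      refine h1.trans ?_
      have h2 : td E (R.filter (fun e => ∀ z ∈ e, z ∈ insert y A)) ≤
          td E (insert s(x, y) (R.filter (fun e => ∀ z ∈ e, z ∈ A))) := by
        apply td_anti
        intro e he
        rw [mem_insert, mem_filter] at he
        rw [mem_filter]
        rcases he with rfl | ⟨he1, he2⟩
        · refine ⟨hxy, ?_⟩
          intro z hz
          rw [Sym2.mem_iff] at hz
          rcases hz with rfl | rfl
          · exact mem_insert_of_mem hx
          · exact mem_insert_self _ _
        · exact ⟨he1, fun z hz => mem_insert_of_mem (he2 z hz)⟩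
      have h3 := td_pendant (E := E) (F := R.filter (fun e => ∀ z ∈ e, z ∈ A)) (x := x) (y := y)
        (D := D) (by rintro rfl; exact hy.2 hx) (by
          intro h
          obtain ⟨e, he, hye⟩ := mem_vs.1 h
          exact hy.2 ((mem_filter.1 he).2 y hye)) hdeg
      rw [pow_succ, mul_assoc]
      exact mul_le_mul_of_nonneg_left (h2.trans h3) (by positivity)
  have h := key (U.card - 1) {v} (by simpa using hc.1) (by simp) (by
    rw [card_sdiff_of_subset (by simpa using hc.1)]; simp)
  refine h.trans ?_
  have h1 : td E (R.filter (fun e => ∀ x ∈ e, x ∈ ({v} : Finset V))) ≤ 1 := by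
    rw [← td_empty E]; exact td_anti (empty_subset _)
  calc _ ≤ (D / Fintype.card V : ℝ) ^ (U.card - 1) * 1 := by gcongr
    _ = _ := mul_one _

/-- percolation count of connected sets -/
lemma percolation (E : Finset (Sym2 V)) (v : V) (D : ℕ) (q : ℝ) (hq0 : 0 ≤ q) (hq1 : q ≤ 1)
    (hdeg : ∀ a : V, (univ.filter (fun b => s(a, b) ∈ E)).card ≤ D) (𝒰 : Finset (Finset V))
    (h𝒰 : ∀ U ∈ 𝒰, Conn E v U) :
    ∑ U ∈ 𝒰, q ^ (U.card - 1) * (1 - q) ^ (D * U.card) ≤ 1 := by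
  have hq : 0 ≤ 1 - q := by linarith
  set X : Finset V := univ.erase v with hX
  set wt : Finset V → ℝ := fun A => q ^ A.card * (1 - q) ^ (X.card - A.card) with hwt
  have hwt0 : ∀ A, 0 ≤ wt A := fun A => by positivity
  have htot : ∑ A ∈ X.powerset, wt A = 1 := by
    rw [hwt, sum_pow_mul_eq_add_pow]; simp
  set bd : Finset V → Finset V := fun U => univ.filter (fun y => y ∉ U ∧ ∃ x ∈ U, s(x, y) ∈ E) with hbd
  set ev : Finset V → Finset (Finset V) := fun U =>
    X.powerset.filter (fun A => U.erase v ⊆ A ∧ Disjoint (bd U) A) with hev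
  have hdisj : (𝒰 : Set (Finset V)).PairwiseDisjoint ev := by
    have hsub : ∀ U ∈ 𝒰, ∀ U' ∈ 𝒰, ∀ A, A ∈ ev U → A ∈ ev U' → U' ⊆ U := by
      intro U hU U' hU' A hA hA'
      simp only [hev, mem_filter] at hA hA'
      by_contra hcon
      have h1 := (h𝒰 U hU).1
      obtain ⟨h1', h2'⟩ := h𝒰 U' hU'
      obtain ⟨x, hx, y, hy, hxy⟩ := h2' (U ∩ U') inter_subset_right (mem_inter.2 ⟨h1, h1'⟩)
        (fun h => hcon (by rw [← h]; exact inter_subset_left))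
      simp only [mem_inter, Finset.mem_sdiff, not_and] at hx hy
      have hyU : y ∉ U := fun h => hy.2 h hy.1
      have hyb : y ∈ bd U := by simp only [hbd, mem_filter, mem_univ, true_and]; exact ⟨hyU, x, hx.1, hxy⟩
      have hyA : y ∈ A := hA'.2.1 (mem_erase.2 ⟨fun h => hyU (h ▸ h1), hy.1⟩)
      exact disjoint_left.1 hA.2.2 hyb hyA
    intro U hU U' hU' hne
    rw [Function.onFun, disjoint_left]
    intro A hA hA'
    exact hne (Subset.antisymm (hsub U' hU' U hU A hA' hA) (hsub U hU U' hU' A hA hA'))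
  have hone : ∀ U ∈ 𝒰, q ^ (U.card - 1) * (1 - q) ^ (D * U.card) ≤ ∑ A ∈ ev U, wt A := by
    intro U hU
    have hv := (h𝒰 U hU).1
    set Y := X \ (U.erase v ∪ bd U) with hY
    have hvb : v ∉ bd U := by simp [hbd, hv]
    have hdis : Disjoint (U.erase v) (bd U) := by
      rw [disjoint_left]; intro x hx hx'
      simp only [hbd, mem_filter] at hx'
      exact hx'.2.1 (mem_of_mem_erase hx)
    have hsubX : U.erase v ∪ bd U ⊆ X := by
      intro x hx
      rw [hX, mem_erase]
      refine ⟨?_, mem_univ _⟩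
      rintro rfl
      rcases mem_union.1 hx with h | h
      · simp at h
      · exact hvb h
    have hXc : X.card = (U.card - 1) + (bd U).card + Y.card := by
      rw [hY, card_sdiff_of_subset hsubX, card_union_of_disjoint hdis, card_erase_of_mem hv]
      have := card_le_card hsubX
      rw [card_union_of_disjoint hdis, card_erase_of_mem hv] at this
      omega
    have hbdc : (bd U).card ≤ D * U.card := by
      have : bd U ⊆ U.biUnion (fun a => univ.filter (fun b => s(a, b) ∈ E)) := by
        intro y hy
        simp only [hbd, mem_filter, mem_univ, true_and] at hy
        simp only [mem_biUnion, mem_filter, mem_univ, true_and]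
        exact hy.2
      refine (card_le_card this).trans ?_
      refine card_biUnion_le.trans ?_
      rw [mul_comm, ← smul_eq_mul, ← sum_const]
      exact sum_le_sum fun a _ => hdeg a
    have hYd : ∀ B ⊆ Y, Disjoint (U.erase v) B := by
      intro B hB
      rw [disjoint_left]; intro x hx hx'
      have := hB hx'
      rw [hY, Finset.mem_sdiff] at this
      exact this.2 (mem_union_left _ hx)
    have himg : ∑ B ∈ Y.powerset, wt (U.erase v ∪ B) ≤ ∑ A ∈ ev U, wt A := by
      rw [← sum_image (g := fun B => U.erase v ∪ B) (f := wt)]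
      · apply sum_le_sum_of_subset_of_nonneg _ (fun A _ _ => hwt0 A)
        intro A hA
        rw [mem_image] at hA
        obtain ⟨B, hB, rfl⟩ := hA
        rw [mem_powerset] at hB
        simp only [hev, mem_filter, mem_powerset]
        refine ⟨union_subset (subset_union_left.trans hsubX) (hB.trans sdiff_subset), subset_union_left, ?_⟩
        rw [disjoint_union_right]
        refine ⟨hdis.symm, ?_⟩
        rw [disjoint_left]; intro x hx hx'
        have := hB hx'
        rw [hY, Finset.mem_sdiff] at this
        exact this.2 (mem_union_right _ hx)
      · intro B hB B' hB' h
        rw [mem_coe, mem_powerset] at hB hB'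
        have h : U.erase v ∪ B = U.erase v ∪ B' := h
        rw [← union_sdiff_cancel_left (hYd B hB), h, union_sdiff_cancel_left (hYd B' hB')]
    refine le_trans ?_ himg
    have e1 : ∑ B ∈ Y.powerset, wt (U.erase v ∪ B)
        = ∑ B ∈ Y.powerset, (q ^ (U.card - 1) * (1 - q) ^ (bd U).card) * (q ^ B.card * (1 - q) ^ (Y.card - B.card)) := by
      refine sum_congr rfl fun B hB => ?_
      rw [mem_powerset] at hB
      have hc : (U.erase v ∪ B).card = U.card - 1 + B.card := by
        rw [card_union_of_disjoint (hYd B hB), card_erase_of_mem hv]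
      have := card_le_card hB
      have h2 : X.card - (U.card - 1 + B.card) = (bd U).card + (Y.card - B.card) := by omega
      simp only [hwt]
      rw [hc, h2]; ring
    rw [e1, ← mul_sum, sum_pow_mul_eq_add_pow]
    simp only [add_sub_cancel, one_pow, mul_one]
    apply mul_le_mul_of_nonneg_left _ (by positivity)
    exact pow_le_pow_of_le_one hq (by linarith) hbdc
  calc _ ≤ ∑ U ∈ 𝒰, ∑ A ∈ ev U, wt A := sum_le_sum hone
    _ = ∑ A ∈ 𝒰.biUnion ev, wt A := (sum_biUnion hdisj).symm
    _ ≤ ∑ A ∈ X.powerset, wt A := by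
        apply sum_le_sum_of_subset_of_nonneg _ (fun A _ _ => hwt0 A)
        intro A hA
        rw [mem_biUnion] at hA
        obtain ⟨U, _, hA⟩ := hA
        exact (mem_filter.1 hA).1
    _ = 1 := htot

end comb2
end Rior

namespace Rior
open Finset

section comb3
variable {V : Type*} [Fintype V] [DecidableEq V]

/-- vertex set closed under adjacency in `R` -/
def Clo (R : Finset (Sym2 V)) (A : Finset V) : Prop := ∀ e ∈ R, ∀ x ∈ e, x ∈ A → ∀ y ∈ e, y ∈ A

open Classical in
/-- vertex set of the component of `v` in `R` -/
noncomputable def cmp (R : Finset (Sym2 V)) (v : V) : Finset V :=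
  univ.filter (fun x => ∀ A : Finset V, v ∈ A → Clo R A → x ∈ A)

lemma mem_cmp {R : Finset (Sym2 V)} {v x : V} :
    x ∈ cmp R v ↔ ∀ A : Finset V, v ∈ A → Clo R A → x ∈ A := by simp [cmp]

lemma cmp_clo (R : Finset (Sym2 V)) (v : V) : Clo R (cmp R v) := by
  intro e he x hx hxU y hy
  rw [mem_cmp] at hxU ⊢
  intro A hv hA
  exact hA e he x hx (hxU A hv hA) y hy

/-- edges of `R` inside `U` -/
def ins (R : Finset (Sym2 V)) (U : Finset V) : Finset (Sym2 V) :=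
  R.filter (fun e => ∀ x ∈ e, x ∈ U)

lemma cmp_conn (R : Finset (Sym2 V)) (v : V) : Conn (ins R (cmp R v)) v (cmp R v) := by
  refine ⟨mem_cmp.2 fun A h _ => h, fun A hA hv hne => ?_⟩
  by_contra hcon
  push Not at hcon
  apply hne
  refine Subset.antisymm hA fun x hx => mem_cmp.1 hx A hv ?_
  intro e he a ha haA b hb
  by_contra hbA
  have hab : a ≠ b := by rintro rfl; exact hbA haA
  have hbU : b ∈ cmp R v := cmp_clo R v e he a ha (hA haA) b hb
  have hee : e = s(a, b) := (Sym2.mem_and_mem_iff hab).1 ⟨ha, hb⟩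
  refine hcon a haA b (Finset.mem_sdiff.2 ⟨hbU, hbA⟩) ?_
  rw [← hee]
  exact mem_filter.2 ⟨he, fun x hx => cmp_clo R v e he a ha (hA haA) x hx⟩

/-- no isolated edges -/
def NI (R : Finset (Sym2 V)) : Prop := ∀ e ∈ R, ∃ e' ∈ R, e' ≠ e ∧ ∃ x ∈ e, x ∈ e'

open Classical in
/-- admissible family: edge sets without isolated edges, with vertices in `S` -/
noncomputable def fam (E : Finset (Sym2 V)) (S : Finset V) : Finset (Finset (Sym2 V)) :=
  E.powerset.filter (fun R => vs R ⊆ S ∧ NI R)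

lemma mem_fam {E R : Finset (Sym2 V)} {S : Finset V} : R ∈ fam E S ↔ R ⊆ E ∧ vs R ⊆ S ∧ NI R := by
  simp [fam]

open Classical in
/-- connected sets of size at least three -/
noncomputable def big (E : Finset (Sym2 V)) (v : V) : Finset (Finset V) :=
  univ.filter (fun U => Conn E v U ∧ 3 ≤ U.card)

lemma vs_ins_subset (R : Finset (Sym2 V)) (U : Finset V) : vs (ins R U) ⊆ U := by
  intro x hx
  obtain ⟨e, he, hxe⟩ := mem_vs.1 hx
  exact (mem_filter.1 he).2 x hxe

lemma cmp_card {E R : Finset (Sym2 V)} {v : V} (hd : ∀ e ∈ E, ¬ e.IsDiag) (hR : R ⊆ E) (hNI : NI R)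
    (hv : v ∈ vs R) : 3 ≤ (cmp R v).card := by
  obtain ⟨e, he, hve⟩ := mem_vs.1 hv
  obtain ⟨e', he', hne, x, hxe, hxe'⟩ := hNI e he
  have hvU : v ∈ cmp R v := mem_cmp.2 fun A h _ => h
  have heU : ∀ y ∈ e, y ∈ cmp R v := cmp_clo R v e he v hve hvU
  have he'U : ∀ y ∈ e', y ∈ cmp R v := cmp_clo R v e' he' x hxe' (heU x hxe)
  have hc : e.toFinset.card = 2 := Sym2.card_toFinset_of_not_isDiag e (hd e (hR he))
  have hc' : e'.toFinset.card = 2 := Sym2.card_toFinset_of_not_isDiag e' (hd e' (hR he'))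
  have hsub : e.toFinset ∪ e'.toFinset ⊆ cmp R v := by
    intro y hy
    rcases mem_union.1 hy with h | h
    · exact heU y (Sym2.mem_toFinset.1 h)
    · exact he'U y (Sym2.mem_toFinset.1 h)
  refine le_trans ?_ (card_le_card hsub)
  by_contra hlt
  push Not at hlt
  have h1 : e.toFinset = e.toFinset ∪ e'.toFinset :=
    eq_of_subset_of_card_le subset_union_left (by omega)
  have h2 : e'.toFinset = e.toFinset ∪ e'.toFinset :=
    eq_of_subset_of_card_le subset_union_right (by omega)
  have h3 : e'.toFinset = e.toFinset := h2.trans h1.symm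
  apply hne
  apply Sym2.ext
  intro y
  rw [← Sym2.mem_toFinset, ← Sym2.mem_toFinset, h3]

lemma fam_bound (E : Finset (Sym2 V)) (hd : ∀ e ∈ E, ¬ e.IsDiag) (D : ℕ)
    (hdeg : ∀ a : V, (univ.filter (fun b => s(a, b) ∈ E)).card ≤ D) (β K θ : ℝ) (hβ : 0 ≤ β)
    (hK : 1 ≤ K) (hθ0 : 0 ≤ θ)
    (hθ : ∀ v, ∑ U ∈ big E v, (1 + β) ^ (ins E U).card * (D / Fintype.card V : ℝ) ^ (U.card - 1)
      * K ^ U.card ≤ θ) (S : Finset V) :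
    ∑ R ∈ fam E S, β ^ R.card * td E R * K ^ (vs R).card ≤ (1 + θ) ^ S.card := by
  classical
  induction hk : S.card using Nat.strong_induction_on generalizing S with
  | _ k ih =>
  rcases S.eq_empty_or_nonempty with rfl | ⟨v, hv⟩
  · have : fam E ∅ ⊆ {∅} := by
      intro R hR
      obtain ⟨_, h2, _⟩ := mem_fam.1 hR
      rw [mem_singleton]
      by_contra hne
      obtain ⟨e, he⟩ := nonempty_iff_ne_empty.2 hne
      have : e.out.1 ∈ vs R := mem_vs.2 ⟨e, he, Sym2.out_fst_mem e⟩
      simpa using h2 this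
    have hle : ∑ R ∈ fam E ∅, β ^ R.card * td E R * K ^ (vs R).card ≤
        ∑ R ∈ {∅}, β ^ R.card * td E R * K ^ (vs R).card :=
      sum_le_sum_of_subset_of_nonneg this (fun R _ _ => by
        have := td_nonneg E R; positivity)
    refine hle.trans ?_
    rw [card_empty] at hk
    simp [td_empty, vs, ← hk]
  set φ : Finset (Sym2 V) → ℝ := fun R => β ^ R.card * td E R * K ^ (vs R).card with hφ
  have hφ0 : ∀ R, 0 ≤ φ R := fun R => by
    have := td_nonneg E R
    simp only [hφ]; positivity
  have hsplit := sum_filter_add_sum_filter_not (fam E S) (fun R => v ∈ vs R) φ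
  rw [← hsplit]
  have hno : ∑ R ∈ (fam E S).filter (fun R => ¬ v ∈ vs R), φ R ≤ (1 + θ) ^ (k - 1) := by
    have hc : (S.erase v).card = k - 1 := by rw [card_erase_of_mem hv, hk]
    have hpos : 0 < S.card := card_pos.2 ⟨v, hv⟩
    refine le_trans ?_ (ih (k-1) (by omega) (S.erase v) hc)
    apply sum_le_sum_of_subset_of_nonneg _ (fun R _ _ => hφ0 R)
    intro R hR
    rw [mem_filter, mem_fam] at hR
    rw [mem_fam]
    refine ⟨hR.1.1, ?_, hR.1.2.2⟩
    intro x hx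
    exact mem_erase.2 ⟨fun h => hR.2 (h ▸ hx), hR.1.2.1 hx⟩
  have hyes : ∑ R ∈ (fam E S).filter (fun R => v ∈ vs R), φ R ≤ θ * (1 + θ) ^ (k - 1) := by
    -- decomposition map
    set g : Finset (Sym2 V) → (Σ _ : Finset V, Finset (Sym2 V) × Finset (Sym2 V)) :=
      fun R => ⟨cmp R v, (ins R (cmp R v), R \ ins R (cmp R v))⟩ with hg
    set tgt : Finset (Σ _ : Finset V, Finset (Sym2 V) × Finset (Sym2 V)) :=
      ((big E v).filter (fun U => U ⊆ S)).sigma (fun U => (ins E U).powerset ×ˢ fam E (S \ U)) with htgt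
    set ψ : (Σ _ : Finset V, Finset (Sym2 V) × Finset (Sym2 V)) → ℝ := fun z =>
      ((D / Fintype.card V : ℝ) ^ (z.1.card - 1) * K ^ z.1.card * β ^ z.2.1.card) * φ z.2.2 with hψ
    have hunion : ∀ R : Finset (Sym2 V), ins R (cmp R v) ∪ (R \ ins R (cmp R v)) = R := by
      intro R
      exact union_sdiff_of_subset (filter_subset _ _)
    have hginj : Set.InjOn g ((fam E S).filter (fun R => v ∈ vs R) : Finset _) := by
      intro R _ R' _ h
      simp only [hg, Sigma.mk.injEq, heq_eq_eq, Prod.mk.injEq] at h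
      obtain ⟨h1, h2, h3⟩ := h
      rw [← hunion R, h3, h2, hunion R']
    have hrest : ∀ R : Finset (Sym2 V), ∀ e ∈ R \ ins R (cmp R v), ∀ x ∈ e, x ∉ cmp R v := by
      intro R e he x hx hxU
      rw [Finset.mem_sdiff] at he
      exact he.2 (mem_filter.2 ⟨he.1, cmp_clo R v e he.1 x hx hxU⟩)
    have hgmem : ∀ R ∈ (fam E S).filter (fun R => v ∈ vs R), g R ∈ tgt := by
      intro R hR
      rw [mem_filter, mem_fam] at hR
      obtain ⟨⟨hRE, hRS, hRN⟩, hvR⟩ := hR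
      have hconn := cmp_conn R v
      have hins : ins R (cmp R v) ⊆ R := filter_subset _ _
      simp only [htgt, hg, mem_sigma, mem_product, mem_powerset, mem_filter, mem_fam]
      refine ⟨⟨?_, ?_⟩, ?_, ?_, ?_, ?_⟩
      · simp only [big, mem_filter, mem_univ, true_and]
        exact ⟨hconn.mono (hins.trans hRE), cmp_card hd hRE hRN hvR⟩
      · -- cmp ⊆ S since vs R is closed
        refine Subset.trans ?_ hRS
        intro x hx
        refine mem_cmp.1 hx (vs R) hvR ?_
        intro e he a _ _ b hb
        exact mem_vs.2 ⟨e, he, hb⟩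
      · intro e he
        have := mem_filter.1 he
        exact mem_filter.2 ⟨hRE this.1, this.2⟩
      · exact sdiff_subset.trans hRE
      · intro x hx
        obtain ⟨e, he, hxe⟩ := mem_vs.1 hx
        exact Finset.mem_sdiff.2 ⟨hRS (mem_vs.2 ⟨e, sdiff_subset he, hxe⟩), hrest R e he x hxe⟩
      · intro e he
        obtain ⟨e', he', hne, x, hx, hx'⟩ := hRN e (sdiff_subset he)
        refine ⟨e', ?_, hne, x, hx, hx'⟩
        rw [Finset.mem_sdiff]
        refine ⟨he', fun h => ?_⟩
        exact hrest R e he x hx ((mem_filter.1 h).2 x hx')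
    have hle : ∀ R ∈ (fam E S).filter (fun R => v ∈ vs R), φ R ≤ ψ (g R) := by
      intro R _
      have hdis : Disjoint (vs (ins R (cmp R v))) (vs (R \ ins R (cmp R v))) := by
        rw [disjoint_left]
        intro x hx hx'
        obtain ⟨e, he, hxe⟩ := mem_vs.1 hx'
        exact hrest R e he x hxe (vs_ins_subset _ _ hx)
      have ht := td_union (E := E) hdis
      rw [hunion] at ht
      have hcard : R.card = (ins R (cmp R v)).card + (R \ ins R (cmp R v)).card := by
        rw [← card_union_of_disjoint disjoint_sdiff, hunion]
      have hvs : (vs R).card ≤ (cmp R v).card + (vs (R \ ins R (cmp R v))).card := by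
        conv_lhs => rw [← hunion R, vs_union]
        refine (card_union_le _ _).trans ?_
        have := card_le_card (vs_ins_subset R (cmp R v))
        omega
      have htd := td_conn (E := E) (cmp_conn R v) hdeg
      simp only [hφ, hψ, hg]
      rw [ht, hcard, pow_add]
      have hKp : K ^ (vs R).card ≤ K ^ (cmp R v).card * K ^ (vs (R \ ins R (cmp R v))).card := by
        rw [← pow_add]; exact pow_le_pow_right₀ hK hvs
      have t1 := td_nonneg E (ins R (cmp R v))
      have t2 := td_nonneg E (R \ ins R (cmp R v))
      set u := (cmp R v).card
      set R1 := ins R (cmp R v)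
      set R2 := R \ R1
      calc β ^ R1.card * β ^ R2.card * (td E R1 * td E R2) * K ^ (vs R).card
          ≤ β ^ R1.card * β ^ R2.card * ((D / Fintype.card V : ℝ) ^ (u - 1) * td E R2) *
            (K ^ u * K ^ (vs R2).card) := by gcongr
        _ = _ := by ring
    calc ∑ R ∈ (fam E S).filter (fun R => v ∈ vs R), φ R
        ≤ ∑ R ∈ (fam E S).filter (fun R => v ∈ vs R), ψ (g R) := sum_le_sum hle
      _ = ∑ z ∈ ((fam E S).filter (fun R => v ∈ vs R)).image g, ψ z := (sum_image hginj).symm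
      _ ≤ ∑ z ∈ tgt, ψ z := by
          apply sum_le_sum_of_subset_of_nonneg
          · intro z hz
            obtain ⟨R, hR, rfl⟩ := mem_image.1 hz
            exact hgmem R hR
          · intro z _ _
            have := hφ0 z.2.2
            simp only [hψ]; positivity
      _ = ∑ U ∈ (big E v).filter (fun U => U ⊆ S), ((1 + β) ^ (ins E U).card *
            (D / Fintype.card V : ℝ) ^ (U.card - 1) * K ^ U.card) * ∑ R2 ∈ fam E (S \ U), φ R2 := by
          rw [htgt, sum_sigma]
          refine sum_congr rfl fun U _ => ?_
          rw [sum_product]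
          have e1 : (1 + β) ^ (ins E U).card = ∑ R1 ∈ (ins E U).powerset, β ^ R1.card := by
            rw [add_comm]
            have := sum_pow_mul_eq_add_pow β 1 (ins E U)
            simpa using this.symm
          rw [e1]
          simp only [hψ, ← mul_sum]
          rw [← sum_mul, ← mul_sum]; ring
      _ ≤ ∑ U ∈ (big E v).filter (fun U => U ⊆ S), ((1 + β) ^ (ins E U).card *
            (D / Fintype.card V : ℝ) ^ (U.card - 1) * K ^ U.card) * (1 + θ) ^ (k - 1) := by
          refine sum_le_sum fun U hU => ?_
          apply mul_le_mul_of_nonneg_left _ (by positivity)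
          rw [mem_filter] at hU
          simp only [big, mem_filter, mem_univ, true_and] at hU
          have hc : (S \ U).card = k - U.card := by rw [card_sdiff_of_subset hU.2, hk]
          have hcU := card_le_card hU.2
          have := ih (k - U.card) (by omega) (S \ U) hc
          refine this.trans ?_
          exact pow_le_pow_right₀ (by linarith) (by omega)
      _ ≤ ∑ U ∈ big E v, ((1 + β) ^ (ins E U).card *
            (D / Fintype.card V : ℝ) ^ (U.card - 1) * K ^ U.card) * (1 + θ) ^ (k - 1) := by
          apply sum_le_sum_of_subset_of_nonneg (filter_subset _ _)
          intro U _ _; positivity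
      _ ≤ _ := by
          rw [← sum_mul]
          exact mul_le_mul_of_nonneg_right (hθ v) (by positivity)
  have hpos : 0 < S.card := card_pos.2 ⟨v, hv⟩
  have : (1 + θ) ^ k = (1 + θ) ^ (k - 1) * (1 + θ) := by
    rw [← pow_succ]; congr 1; omega
  rw [this]
  linarith

end comb3
end Rior

namespace Rior
open Finset

section comb4
variable {V : Type*} [Fintype V] [DecidableEq V]

lemma theta_bound [Nonempty V] (E : Finset (Sym2 V)) (v : V) (D : ℕ) (hD : 1 ≤ D)
    (hdeg : ∀ a : V, (univ.filter (fun b => s(a, b) ∈ E)).card ≤ D) (β Q K : ℝ) (hβ : 0 ≤ β) (hQ0 : 0 ≤ Q)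
    (hK : 1 ≤ K)
    (hQ : ∀ U : Finset V, 3 ≤ U.card → (1 + β) ^ (ins E U).card ≤ Q ^ (U.card - 2))
    (h1 : (4 * K) * D ^ 4 * Q / Fintype.card V ≤ 1) :
    ∑ U ∈ big E v, (1+β)^(ins E U).card*(D/Fintype.card V:ℝ)^(U.card-1)*K^U.card
      ≤ (4 * K) ^ 3 * D ^ 4 * Q / (Fintype.card V : ℝ) ^ 2 := by
  have hn : (0:ℝ) < Fintype.card V := by exact_mod_cast Fintype.card_pos
  set n : ℝ := ((Fintype.card V : ℕ) : ℝ) with hn'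
  have hD' : (1:ℝ) ≤ D := by exact_mod_cast hD
  have hD0 : (0:ℝ) < D := by linarith
  set q : ℝ := 1 / (2 * D) with hq
  have hq0 : 0 ≤ q := by positivity
  have hq1 : q ≤ 1 := by rw [hq, div_le_one (by positivity)]; linarith
  set x : ℝ := (4 * K) * D ^ 4 * Q / n with hx
  have hx0 : 0 ≤ x := by positivity
  have hhalf : (1/2 : ℝ) ≤ (1 - q) ^ D := by
    have := one_add_mul_le_pow (a := -q) (by linarith) D
    have e : 1 + (D:ℝ) * (-q) = 1/2 := by rw [hq]; field_simp; norm_num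
    rw [e] at this
    simpa [sub_eq_add_neg] using this
  have hP := percolation E v D q hq0 hq1 hdeg (big E v) (fun U hU => by
    simp only [big, mem_filter] at hU; exact hU.2.1)
  have hterm : ∀ U ∈ big E v, (1+β)^(ins E U).card*(D/n:ℝ)^(U.card-1)*K^U.card ≤
      (q ^ (U.card - 1) * (1 - q) ^ (D * U.card)) * ((4 * K) ^ 3 * D ^ 4 * Q / n ^ 2) := by
    intro U hU
    simp only [big, mem_filter] at hU
    have hu := hU.2.2
    obtain ⟨j, hj⟩ : ∃ j, U.card = j + 3 := ⟨U.card - 3, by omega⟩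
    have hQU := hQ U hu
    rw [hj] at hQU ⊢
    have e1 : j + 3 - 2 = j + 1 := by omega
    have e2 : j + 3 - 1 = j + 2 := by omega
    rw [e1] at hQU
    rw [e2]
    have hw : (1/(2*D:ℝ))^(j+2) * (1/2)^(j+3) ≤ q ^ (j+2) * (1 - q) ^ (D * (j+3)) := by
      rw [pow_mul]
      gcongr
    have hpow : x ^ (j+1) ≤ x := pow_le_of_le_one hx0 h1 (by omega)
    calc (1+β)^(ins E U).card*(D/n:ℝ)^(j+2)*K^(j+3) ≤ Q ^ (j+1) *(D/n:ℝ)^(j+2)*K^(j+3) := by gcongr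
      _ ≤ (1/(2*D:ℝ))^(j+2) * (1/2)^(j+3) * ((4*K)^2 / n * x^(j+1)) := by
        rw [hx]
        have hDp : (D:ℝ)^(2*(j+2)) ≤ (D:ℝ)^(4*(j+1)) := pow_le_pow_right₀ hD' (by omega)
        have eq1 : (1/(2*D:ℝ))^(j+2) * (1/2)^(j+3) * ((4*K)^2 / n * (4 * K * D ^ 4 * Q / n)^(j+1))
          = (Q^(j+1) * K^(j+3) / n^(j+2) * (1/D^(j+2))) * D^(4*(j+1)) * 2 := by
          have h4 : (4:ℝ) = 2 * 2 := by norm_num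
          simp only [div_pow, mul_pow, one_pow, h4]
          field_simp
          ring
        have eq2 : Q ^ (j+1) *(D/n:ℝ)^(j+2)*K^(j+3)
          = (Q^(j+1) * K^(j+3) / n^(j+2) * (1/D^(j+2))) * D^(2*(j+2)) := by
          simp only [div_pow]
          field_simp
          ring
        rw [eq1, eq2]
        have h0 : 0 ≤ Q^(j+1) * K^(j+3) / n^(j+2) * (1/(D:ℝ)^(j+2)) := by positivity
        have h2 := mul_le_mul_of_nonneg_left hDp h0
        have h3 : 0 ≤ (Q^(j+1) * K^(j+3) / n^(j+2) * (1/(D:ℝ)^(j+2))) * (D:ℝ)^(4*(j+1)) := by positivity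
        linarith
      _ ≤ q ^ (j+2) * (1 - q) ^ (D * (j+3)) * ((4*K)^2 / n * x) := by gcongr
      _ = _ := by rw [hx]; field_simp
  calc _ ≤ ∑ U ∈ big E v, (q ^ (U.card - 1) * (1 - q) ^ (D * U.card)) * ((4 * K) ^ 3 * D ^ 4 * Q / n ^ 2) :=
        sum_le_sum hterm
    _ = (∑ U ∈ big E v, (q ^ (U.card - 1) * (1 - q) ^ (D * U.card))) * ((4 * K) ^ 3 * D ^ 4 * Q / n ^ 2) := by
        rw [sum_mul]
    _ ≤ 1 * ((4 * K) ^ 3 * D ^ 4 * Q / n ^ 2) := by gcongr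
    _ = _ := one_mul _

end comb4
end Rior

namespace Rior
open Finset

section comb5
variable {V : Type*} [Fintype V] [DecidableEq V]

/-- isolated edges of `F` -/
def mpart (F : Finset (Sym2 V)) : Finset (Sym2 V) :=
  F.filter (fun e => ∀ e' ∈ F, e' ≠ e → ∀ x ∈ e, x ∉ e')

lemma mpart_matched (F : Finset (Sym2 V)) : Matched (mpart F) := by
  intro e he e' he' hne x hx
  exact (mem_filter.1 he).2 e' (mem_filter.1 he').1 hne x hx

lemma rest_NI (F : Finset (Sym2 V)) : NI (F \ mpart F) := by
  intro e he
  rw [Finset.mem_sdiff] at he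
  obtain ⟨he, hne⟩ := he
  have : ¬ ∀ e' ∈ F, e' ≠ e → ∀ x ∈ e, x ∉ e' := fun h => hne (mem_filter.2 ⟨he, h⟩)
  push Not at this
  obtain ⟨e', he', hne', x, hx, hx'⟩ := this
  refine ⟨e', Finset.mem_sdiff.2 ⟨he', fun h => ?_⟩, hne', x, hx, hx'⟩
  exact (mem_filter.1 h).2 e he hne'.symm x hx' hx

lemma mpart_disj (F : Finset (Sym2 V)) : Disjoint (vs (mpart F)) (vs (F \ mpart F)) := by
  rw [Finset.disjoint_left]
  intro x hx hx'
  obtain ⟨e, he, hxe⟩ := mem_vs.1 hx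
  obtain ⟨e', he', hxe'⟩ := mem_vs.1 hx'
  rw [Finset.mem_sdiff] at he'
  exact (mem_filter.1 he).2 e' he'.1 (fun h => he'.2 (h ▸ he)) x hxe hxe'

lemma mpart_union (F : Finset (Sym2 V)) : mpart F ∪ (F \ mpart F) = F :=
  union_sdiff_of_subset (filter_subset _ _)

lemma F_bound [Nonempty V] (E : Finset (Sym2 V)) (m : ℕ)
    (h2 : (univ.filter (fun q : V × V => s(q.1, q.2) ∈ E)).card ≤ 2 * m)
    (β : ℝ) (hβ : 0 ≤ β) (F : Finset (Sym2 V)) (hd : ∀ e ∈ F, ¬ e.IsDiag) :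
    β ^ F.card * (Real.exp (4 * ((vs F).card : ℝ)^2 / Fintype.card V) * td E F) ≤
      (if 2 * (mpart F).card ≤ Fintype.card V then
        (β * (2 * m / (Fintype.card V : ℝ)^2)) ^ (mpart F).card *
          Real.exp (16 * ((mpart F).card : ℝ)^2 / Fintype.card V) else 0) *
      (β ^ (F \ mpart F).card * td E (F \ mpart F) * (Real.exp 8) ^ (vs (F \ mpart F)).card) := by
  have hn : (0:ℝ) < Fintype.card V := by exact_mod_cast Fintype.card_pos
  obtain ⟨b1, b2⟩ := matching_bounds m h2 (mpart F) (fun e he => hd e (mem_filter.1 he).1) (mpart_matched F)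
  have hdis := mpart_disj F
  have htd : td E F = td E (mpart F) * td E (F \ mpart F) := by
    conv_lhs => rw [← mpart_union F]
    exact td_union hdis
  have hvs : (vs F).card = 2 * (mpart F).card + (vs (F \ mpart F)).card := by
    conv_lhs => rw [← mpart_union F, vs_union, card_union_of_disjoint hdis, b2]
  have hcard : F.card = (mpart F).card + (F \ mpart F).card := by
    conv_lhs => rw [← mpart_union F]
    exact card_union_of_disjoint disjoint_sdiff
  have hle : (vs F).card ≤ Fintype.card V := card_le_univ _
  rw [htd, hcard]
  set R := F \ mpart F
  set s := (mpart F).card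
  set w := (vs R).card
  have h2s : 2 * s ≤ Fintype.card V := by omega
  rw [if_pos h2s]
  have hle' : 2 * (s:ℝ) + w ≤ Fintype.card V := by
    rw [hvs] at hle; exact_mod_cast hle
  have hvs' : ((vs F).card : ℝ) = 2 * s + w := by rw [hvs]; push_cast; ring
  rw [hvs']
  set n : ℝ := ((Fintype.card V : ℕ) : ℝ)
  have hexp : Real.exp (4 * (2 * (s:ℝ) + w)^2 / n) ≤ Real.exp (16 * (s:ℝ)^2/n) * Real.exp 8 ^ w := by
    rw [← Real.exp_nat_mul, ← Real.exp_add]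
    apply Real.exp_le_exp.2
    rw [div_add' _ _ _ hn.ne']
    apply div_le_div_of_nonneg_right _ hn.le
    have hs0 : (0:ℝ) ≤ s := by positivity
    have hw0 : (0:ℝ) ≤ w := by positivity
    nlinarith
  have t1 := td_nonneg E (mpart F)
  have t2 := td_nonneg E R
  rw [pow_add, mul_pow]
  calc β ^ s * β ^ R.card * (Real.exp (4 * (2 * (s:ℝ) + w) ^ 2 / n) * (td E (mpart F) * td E R))
      ≤ β ^ s * β ^ R.card * ((Real.exp (16 * (s:ℝ)^2/n) * Real.exp 8 ^ w) * ((2 * m / n^2) ^ s * td E R)) := by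
        gcongr
    _ = _ := by ring

lemma perm_sum [Nonempty V] (E : Finset (Sym2 V)) (m D : ℕ) (hm : E.card = m) (hd : ∀ e ∈ E, ¬ e.IsDiag)
    (h2 : (univ.filter (fun q : V × V => s(q.1, q.2) ∈ E)).card ≤ 2 * m)
    (hdeg : ∀ a : V, (univ.filter (fun b => s(a, b) ∈ E)).card ≤ D)
    (β θ : ℝ) (hβ : 0 ≤ β) (hθ0 : 0 ≤ θ)
    (hθ : ∀ v, ∑ U ∈ big E v, (1+β)^(ins E U).card*(D/Fintype.card V:ℝ)^(U.card-1)*(Real.exp 8)^U.card ≤ θ) :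
    ∑ σ : Equiv.Perm V, (1 + β) ^ (E.filter (fun e => Sym2.map σ e ∈ E)).card ≤
      (Fintype.card V).factorial * ((∑ s ∈ range (m+1), (m.choose s : ℝ) * 
        (if 2 * s ≤ Fintype.card V then
        (β * (2 * m / (Fintype.card V : ℝ)^2)) ^ s *
          Real.exp (16 * (s : ℝ)^2 / Fintype.card V) else 0)) * (1 + θ) ^ Fintype.card V) := by
  set f : ℕ → ℝ := fun s => (if 2 * s ≤ Fintype.card V then
        (β * (2 * m / (Fintype.card V : ℝ)^2)) ^ s *
          Real.exp (16 * (s : ℝ)^2 / Fintype.card V) else 0) with hf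
  set g : Finset (Sym2 V) → ℝ := fun R => β ^ R.card * td E R * (Real.exp 8) ^ (vs R).card with hg
  have hf0 : ∀ s, 0 ≤ f s := by
    intro s; simp only [hf]; split_ifs <;> positivity
  have hg0 : ∀ R, 0 ≤ g R := by
    intro R; have := td_nonneg E R; simp only [hg]; positivity
  have hexpand : ∀ σ : Equiv.Perm V, (1 + β) ^ (E.filter (fun e => Sym2.map σ e ∈ E)).card =
      ∑ F ∈ E.powerset, if pres E F σ then β ^ F.card else 0 := by
    intro σ
    rw [← sum_filter]
    have : E.powerset.filter (fun F => pres E F σ) = (E.filter (fun e => Sym2.map σ e ∈ E)).powerset := by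
      ext F
      rw [mem_filter, mem_powerset, mem_powerset]
      simp only [subset_iff, mem_filter]
      constructor
      · rintro ⟨a, b⟩ e he; exact ⟨a he, b e he⟩
      · intro h; exact ⟨fun e he => (h he).1, fun e he => (h he).2⟩
    rw [this, add_comm 1 β]
    have := Finset.sum_pow_mul_eq_add_pow β (1:ℝ) (E.filter (fun e => Sym2.map σ e ∈ E))
    rw [← this]
    simp
  calc _ = ∑ σ : Equiv.Perm V, ∑ F ∈ E.powerset, (if pres E F σ then β ^ F.card else 0) :=
        sum_congr rfl fun σ _ => hexpand σ
    _ = ∑ F ∈ E.powerset, β ^ F.card * ((univ.filter (fun σ : Equiv.Perm V => pres E F σ)).card : ℝ) := by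
        rw [sum_comm]
        apply sum_congr rfl
        intro F _
        rw [← sum_filter, sum_const, nsmul_eq_mul, mul_comm]
    _ ≤ ∑ F ∈ E.powerset, (Fintype.card V).factorial * (f (mpart F).card * g (F \ mpart F)) := by
        apply sum_le_sum
        intro F hF
        have hF' := mem_powerset.1 hF
        have h1 := F_bound E m h2 β hβ F (fun e he => hd e (hF' he))
        have h3 := perm_bound E F
        calc _ ≤ β ^ F.card * ((Fintype.card V).factorial * (Real.exp (4 * ((vs F).card : ℝ)^2 / Fintype.card V) * td E F)) := by
              gcongr
          _ = (Fintype.card V).factorial * (β ^ F.card * (Real.exp (4 * ((vs F).card : ℝ)^2 / Fintype.card V) * td E F)) := by ring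
          _ ≤ _ := by
            apply mul_le_mul_of_nonneg_left _ (by positivity)
            exact h1
    _ = (Fintype.card V).factorial * ∑ F ∈ E.powerset, f (mpart F).card * g (F \ mpart F) := by
        rw [mul_sum]
    _ ≤ (Fintype.card V).factorial * ∑ z ∈ E.powerset ×ˢ fam E univ, f z.1.card * g z.2 := by
        apply mul_le_mul_of_nonneg_left _ (by positivity)
        have hinj : Set.InjOn (fun F : Finset (Sym2 V) => (mpart F, F \ mpart F)) (E.powerset : Finset _) := by
          intro F _ F' _ h
          simp only [Prod.mk.injEq] at h
          calc F = mpart F ∪ (F \ mpart F) := (mpart_union F).symm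
            _ = mpart F' ∪ (F' \ mpart F') := by rw [h.2, h.1]
            _ = F' := mpart_union F'
        have himg := sum_image (f := fun z : Finset (Sym2 V) × Finset (Sym2 V) => f z.1.card * g z.2) hinj
        simp only at himg
        rw [← himg]
        apply sum_le_sum_of_subset_of_nonneg
        · intro z hz
          obtain ⟨F, hF, rfl⟩ := mem_image.1 hz
          have hF' := mem_powerset.1 hF
          refine mem_product.2 ⟨mem_powerset.2 ((filter_subset _ _).trans hF'), mem_fam.2 ⟨sdiff_subset.trans hF', subset_univ _, rest_NI F⟩⟩
        · intro z _ _
          exact mul_nonneg (hf0 _) (hg0 _)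
    _ = (Fintype.card V).factorial * ((∑ M ∈ E.powerset, f M.card) * ∑ R ∈ fam E univ, g R) := by
        rw [sum_mul_sum, sum_product]
    _ ≤ (Fintype.card V).factorial * ((∑ M ∈ E.powerset, f M.card) * (1 + θ) ^ Fintype.card V) := by
        have hfb := fam_bound E hd D hdeg β (Real.exp 8) θ hβ (Real.one_le_exp (by norm_num)) hθ0 hθ univ
        rw [card_univ] at hfb
        apply mul_le_mul_of_nonneg_left _ (by positivity)
        apply mul_le_mul_of_nonneg_left hfb (sum_nonneg fun _ _ => hf0 _)
    _ = _ := by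
        rw [Finset.sum_powerset_apply_card, hm]
        simp only [nsmul_eq_mul, hf]

end comb5
end Rior

namespace Rior
open Finset

lemma scal_sum (n m : ℕ) (hn : 0 < n) (β L lam : ℝ) (hβ : 0 ≤ β) (hL : 0 ≤ L)
    (hlam : lam = m * (β * (2 * m / (n:ℝ)^2))) :
    (∑ s ∈ range (m+1), (m.choose s : ℝ) *
        (if 2 * s ≤ n then (β * (2 * m / (n : ℝ)^2)) ^ s * Real.exp (16 * (s : ℝ)^2 / n) else 0))
      ≤ Real.exp (lam * Real.exp (16 * L / n)) + Real.exp (Real.exp 9 * lam - L) := by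
  have hn' : (0:ℝ) < n := by exact_mod_cast hn
  have hlam0 : 0 ≤ lam := by rw [hlam]; positivity
  set x := β * (2 * m / (n : ℝ)^2) with hx
  have hx0 : 0 ≤ x := by positivity
  have hterm : ∀ s ∈ range (m+1), (m.choose s : ℝ) *
        (if 2 * s ≤ n then x ^ s * Real.exp (16 * (s : ℝ)^2 / n) else 0) ≤
        (lam * Real.exp (16 * L / n)) ^ s / s.factorial +
          Real.exp (-L) * ((Real.exp 9 * lam) ^ s / s.factorial) := by
    intro s _
    have hc : (m.choose s : ℝ) ≤ (m:ℝ)^s / s.factorial := Nat.choose_le_pow_div s m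
    split_ifs with h
    · have h' : 2 * (s:ℝ) ≤ n := by exact_mod_cast h
      have hs0 : (0:ℝ) ≤ s := by positivity
      have e1 : (m.choose s : ℝ) * (x ^ s * Real.exp (16 * (s : ℝ)^2 / n)) ≤
          lam ^ s / s.factorial * Real.exp (16 * (s : ℝ)^2 / n) := by
        rw [hlam, mul_pow (m:ℝ) x s, ← mul_assoc]
        have : (m.choose s : ℝ) * x ^ s ≤ (m:ℝ)^s / s.factorial * x ^ s := by gcongr
        calc _ ≤ (m:ℝ)^s / s.factorial * x ^ s * Real.exp (16 * (s : ℝ)^2 / n) := by gcongr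
          _ = _ := by ring
      refine e1.trans ?_
      by_cases hsL : (s:ℝ) ≤ L
      · have : Real.exp (16 * (s : ℝ)^2 / n) ≤ Real.exp (16 * L / n) ^ s := by
          rw [← Real.exp_nat_mul]
          apply Real.exp_le_exp.2
          rw [mul_div_assoc', div_le_div_iff_of_pos_right hn']
          nlinarith
        calc _ ≤ lam ^ s / s.factorial * Real.exp (16 * L / n) ^ s := by gcongr
          _ = (lam * Real.exp (16 * L / n)) ^ s / s.factorial := by rw [mul_pow]; ring
          _ ≤ _ := by
            have : 0 ≤ Real.exp (-L) * ((Real.exp 9 * lam) ^ s / s.factorial) := by positivity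
            linarith
      · have : Real.exp (16 * (s : ℝ)^2 / n) ≤ Real.exp (-L) * Real.exp 9 ^ s := by
          rw [← Real.exp_nat_mul, ← Real.exp_add]
          apply Real.exp_le_exp.2
          have : 16 * (s : ℝ)^2 / n ≤ 8 * s := by
            rw [div_le_iff₀ hn']; nlinarith
          linarith
        calc _ ≤ lam ^ s / s.factorial * (Real.exp (-L) * Real.exp 9 ^ s) := by gcongr
          _ = Real.exp (-L) * ((Real.exp 9 * lam) ^ s / s.factorial) := by rw [mul_pow]; ring
          _ ≤ _ := by
            have : 0 ≤ (lam * Real.exp (16 * L / n)) ^ s / s.factorial := by positivity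
            linarith
    · rw [mul_zero]; positivity
  calc _ ≤ ∑ s ∈ range (m+1), ((lam * Real.exp (16 * L / n)) ^ s / s.factorial +
          Real.exp (-L) * ((Real.exp 9 * lam) ^ s / s.factorial)) := sum_le_sum hterm
    _ = ∑ s ∈ range (m+1), (lam * Real.exp (16 * L / n)) ^ s / s.factorial +
          Real.exp (-L) * ∑ s ∈ range (m+1), (Real.exp 9 * lam) ^ s / s.factorial := by
        rw [sum_add_distrib, mul_sum]
    _ ≤ Real.exp (lam * Real.exp (16 * L / n)) + Real.exp (-L) * Real.exp (Real.exp 9 * lam) := by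
        have a1 := Real.sum_le_exp_of_nonneg (x := lam * Real.exp (16 * L / n)) (by positivity) (m+1)
        have a2 := Real.sum_le_exp_of_nonneg (x := Real.exp 9 * lam) (by positivity) (m+1)
        gcongr
    _ = _ := by rw [← Real.exp_add]; ring_nf

section app
variable {V : Type*} [Fintype V] [DecidableEq V]

lemma two_sum (E : Finset (Sym2 V)) (b : ℝ) :
    ∑ π : Equiv.Perm V, ∑ π' : Equiv.Perm V,
      b ^ (E.image (Sym2.map π) ∩ E.image (Sym2.map π')).card =
    (Fintype.card V).factorial * ∑ σ : Equiv.Perm V, b ^ (E.filter (fun e => Sym2.map σ e ∈ E)).card := by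
  have key : ∀ π π' : Equiv.Perm V, (E.image (Sym2.map π) ∩ E.image (Sym2.map π')).card =
      (E.filter (fun e => Sym2.map (π'⁻¹ * π : Equiv.Perm V) e ∈ E)).card := by
    intro π π'
    rw [← card_image_of_injective (E.filter _) (Sym2.map.injective π.injective)]
    congr 1
    ext e
    simp only [mem_inter, mem_image, mem_filter]
    constructor
    · rintro ⟨⟨a, ha, rfl⟩, b, hb, hab⟩
      refine ⟨a, ⟨ha, ?_⟩, rfl⟩
      have : Sym2.map (π'⁻¹ * π : Equiv.Perm V) a = b := by
        apply Sym2.map.injective π'.injective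
        rw [hab, Sym2.map_map]
        congr 1
        ext x; simp
      rw [this]; exact hb
    · rintro ⟨a, ⟨ha, ha'⟩, rfl⟩
      refine ⟨⟨a, ha, rfl⟩, _, ha', ?_⟩
      rw [Sym2.map_map]
      congr 1
      ext x; simp
  simp_rw [key]
  rw [sum_comm]
  have : ∀ π' : Equiv.Perm V, ∑ π : Equiv.Perm V, b ^ (E.filter (fun e => Sym2.map (π'⁻¹ * π : Equiv.Perm V) e ∈ E)).card
      = ∑ σ : Equiv.Perm V, b ^ (E.filter (fun e => Sym2.map σ e ∈ E)).card := by
    intro π'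
    exact Fintype.sum_equiv (Equiv.mulLeft π'⁻¹) _ _ (fun π => by simp)
  rw [sum_congr rfl (fun π' _ => this π'), sum_const, card_univ, Fintype.card_perm, nsmul_eq_mul]

lemma finite_bound [Nonempty V] (E : Finset (Sym2 V)) (m D M : ℕ) (hm : E.card = m) (hd : ∀ e ∈ E, ¬ e.IsDiag)
    (h2 : (univ.filter (fun q : V × V => s(q.1, q.2) ∈ E)).card ≤ 2 * m)
    (hdeg : ∀ a : V, (univ.filter (fun b => s(a, b) ∈ E)).card ≤ D) (hD : 1 ≤ D)
    (N n : ℕ) (hN : Fintype.card (Sym2 V) = N) (hn : Fintype.card V = n)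
    (hM : 2 * m < M) (hMN : M ≤ N) (β Q L lam : ℝ) (hβ : β = ((N:ℝ) - M) / ((M:ℝ) - 2 * m)) (hL : 0 ≤ L)
    (hlam : lam = m * (β * (2 * m / (n:ℝ)^2))) (hQ0 : 0 ≤ Q)
    (hQ : ∀ U : Finset V, 3 ≤ U.card → (1 + β) ^ (ins E U).card ≤ Q ^ (U.card - 2))
    (h1 : (4 * Real.exp 8) * D ^ 4 * Q / n ≤ 1) :
    (((powersetCard M univ).filter (fun A => ∀ π : Equiv.Perm V, ¬ E.image (Sym2.map π) ⊆ A)).card : ℝ) ≤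
      (Real.exp (-((m:ℝ)^2 * ((N:ℝ) - M)/((N:ℝ)*M))) *
        ((Real.exp (lam * Real.exp (16 * L / n)) + Real.exp (Real.exp 9 * lam - L)) *
          Real.exp ((4 * Real.exp 8)^3 * D ^ 4 * Q / n)) - 1) * (N.choose M : ℝ) := by
  have hn0 : 0 < n := by rw [← hn]; exact Fintype.card_pos
  have hn' : (0:ℝ) < n := by exact_mod_cast hn0
  have hM' : (2 * m : ℝ) < M := by exact_mod_cast hM
  have hMN' : (M:ℝ) ≤ N := by exact_mod_cast hMN
  have hβ0 : 0 ≤ β := by rw [hβ]; apply div_nonneg <;> linarith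
  set θ : ℝ := (4 * Real.exp 8)^3 * D ^ 4 * Q / (n:ℝ)^2 with hθ
  have hθ0 : 0 ≤ θ := by positivity
  have hps := perm_sum E m D hm hd h2 hdeg β θ hβ0 hθ0 (fun v => by
    have := theta_bound E v D hD hdeg β Q (Real.exp 8) hβ0 hQ0 (Real.one_le_exp (by norm_num)) hQ (by rw [hn]; exact h1)
    rw [hn] at this ⊢
    exact this)
  have hss := scal_sum n m hn0 β L lam hβ0 hL hlam
  have hth : (1 + θ) ^ n ≤ Real.exp ((4 * Real.exp 8)^3 * D ^ 4 * Q / n) := by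
    calc (1 + θ) ^ n ≤ (Real.exp θ) ^ n := by
          gcongr
          linarith [Real.add_one_le_exp θ]
      _ = _ := by
          rw [← Real.exp_nat_mul, hθ]
          congr 1
          field_simp
  subst hN
  apply slice_bound (fun π : Equiv.Perm V => E.image (Sym2.map π)) m M
    (fun π => by rw [card_image_of_injective _ (Sym2.map.injective π.injective), hm]) hM hMN
  have hb : ((Fintype.card (Sym2 V) : ℝ) - 2 * m) / ((M:ℝ) - 2 * m) = 1 + β := by
    have : (M:ℝ) - 2 * m ≠ 0 := by linarith
    rw [hβ, ← div_self this, ← add_div]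
    congr 1
    ring
  rw [hb, two_sum, Fintype.card_perm]
  rw [hn] at hps ⊢
  rw [mul_assoc]
  apply mul_le_mul_of_nonneg_left _ (Real.exp_pos _).le
  calc _ ≤ (n.factorial : ℝ) * (n.factorial * ((∑ s ∈ range (m+1), (m.choose s : ℝ) * 
        (if 2 * s ≤ n then (β * (2 * m / (n : ℝ)^2)) ^ s * Real.exp (16 * (s : ℝ)^2 / n) else 0)) * (1 + θ) ^ n)) := by
        gcongr
    _ ≤ (n.factorial : ℝ) * (n.factorial * ((Real.exp (lam * Real.exp (16 * L / n)) + Real.exp (Real.exp 9 * lam - L)) *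
          Real.exp ((4 * Real.exp 8)^3 * D ^ 4 * Q / n))) := by
        gcongr
    _ = _ := by ring

end app
end Rior

namespace Rior
open Finset

lemma core_a {t w D p m M N : ℝ} (ht : 1 ≤ t) (hw : 8 ≤ w) (hD : 1 ≤ D) (hp0 : 0 < p)
    (hp : D^2 * w ≤ p * t^2) (hN : N = t^4 * (t^4+1)/2) (hm : m ≤ t^4 * D / 2)
    (hM : p * N - t^5 ≤ M) : p * N * (1 - 4 / (D * w * t)) ≤ M - 2 * m := by
  have h1 : t^8 / 2 ≤ N := by rw [hN]; nlinarith [pow_pos (by linarith : 0 < t) 4]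
  have h2 : 2 * t^5 * D ≤ p * N * (4 / (D * w * t)) := by
    rw [mul_div_assoc', le_div_iff₀ (by positivity)]
    calc 2 * t^5 * D * (D * w * t) = 2 * t^6 * (D^2 * w) := by ring
      _ ≤ 2 * t^6 * (p * t^2) := by gcongr
      _ = p * (t^8 / 2) * 4 := by ring
      _ ≤ p * N * 4 := by gcongr
  have h3 : t^4 * D ≤ t^5 * D := by gcongr; norm_num
  have h4 : t^5 * 1 ≤ t^5 * D := by gcongr
  linarith

lemma core_b {t w D p m M N : ℝ} (ht : 1 ≤ t) (hw : 8 ≤ w) (hD : 1 ≤ D) (hp0 : 0 < p)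
    (hp : D^2 * w ≤ p * t^2) (hN : N = t^4 * (t^4+1)/2) (hm : m ≤ t^4 * D / 2)
    (hM : p * N - t^5 ≤ M) : p * N / 2 ≤ M - 2 * m ∧ D^2 * w * t^6 / 4 ≤ M - 2 * m := by
  have h := core_a ht hw hD hp0 hp hN hm hM
  have h1 : t^8 / 2 ≤ N := by rw [hN]; nlinarith [pow_pos (by linarith : 0 < t) 4]
  have hx : 4 / (D * w * t) ≤ 1/2 := by
    rw [div_le_iff₀ (by positivity)]
    have : 8 ≤ D * w * t := by
      calc (8:ℝ) = 1 * 8 * 1 := by norm_num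
        _ ≤ D * w * t := by gcongr
    linarith
  have h0 : 0 ≤ N := le_trans (by positivity) h1
  have h2 : p * N / 2 ≤ M - 2 * m := by
    refine le_trans ?_ h
    rw [div_eq_mul_inv]
    apply mul_le_mul_of_nonneg_left _ (by positivity)
    linarith
  refine ⟨h2, le_trans ?_ h2⟩
  calc D^2 * w * t^6 / 4 ≤ p * t^2 * t^6 / 4 := by gcongr
    _ = p * (t^8/2) / 2 := by ring
    _ ≤ _ := by gcongr

lemma core_c {t w D p m M N lam : ℝ} (ht : 1 ≤ t) (hw : 8 ≤ w) (hD : 1 ≤ D) (hp0 : 0 < p)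
    (hp : D^2 * w ≤ p * t^2) (hN : N = t^4 * (t^4+1)/2) (hm0 : 0 ≤ m) (hm : m ≤ t^4 * D / 2)
    (hM : p * N - t^5 ≤ M) (hlam : lam = m * ((N - M) / (M - 2 * m) * (2 * m / (t^4)^2))) :
    lam ≤ t^2 / w := by
  obtain ⟨h1, h2⟩ := core_b ht hw hD hp0 hp hN hm hM
  have hN0 : 0 < N := by rw [hN]; positivity
  have hM' : 0 < M - 2 * m := lt_of_lt_of_le (by positivity) h2
  have hb : (N - M) / (M - 2 * m) ≤ 2 / p := by
    rw [div_le_div_iff₀ hM' hp0]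
    nlinarith
  calc lam = (N - M) / (M - 2 * m) * (2 * m^2 / (t^4)^2) := by rw [hlam]; ring
    _ ≤ 2 / p * (2 * (t^4 * D / 2)^2 / (t^4)^2) := by gcongr
    _ = D^2 / p := by field_simp
    _ ≤ t^2 / w := by rw [div_le_div_iff₀ hp0 (by positivity)]; linarith

lemma core_d {t w D p m M N lam : ℝ} (ht : 1 ≤ t) (hw : 8 ≤ w) (hD : 1 ≤ D) (hp0 : 0 < p)
    (hp : D^2 * w ≤ p * t^2) (hN : N = t^4 * (t^4+1)/2) (hm0 : 0 ≤ m) (hm : m ≤ t^4 * D / 2)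
    (hM : p * N - t^5 ≤ M) (hMN : M ≤ N) (hlam : lam = m * ((N - M) / (M - 2 * m) * (2 * m / (t^4)^2))) :
    lam - m^2 * (N - M) / (N * M) ≤ 5 / w := by
  obtain ⟨h1, h2⟩ := core_b ht hw hD hp0 hp hN hm hM
  have hN0 : 0 < N := by rw [hN]; positivity
  have ht0 : 0 < t := by linarith
  have hM' : 0 < M - 2 * m := lt_of_lt_of_le (by positivity) h2
  have hM0 : 0 < M := by linarith
  set M' := M - 2 * m with hMd
  have e1 : lam - m^2 * (N - M) / (N * M) = (N - M) / N * (m^2 / (t^4 * M') + 2 * m^3 / (M * M')) := by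
    have hMe : M = M' + 2 * m := by rw [hMd]; ring
    have h2N : 2 / (t^4)^2 = (1 + 1/t^4) / N := by
      rw [hN]; field_simp
    have : lam = m^2 * (N - M) / M' * (2 / (t^4)^2) := by rw [hlam]; ring
    rw [this, h2N]
    field_simp
    rw [hMe]
    ring
  rw [e1]
  have hfr : (N - M) / N ≤ 1 := by rw [div_le_one hN0]; linarith
  have hfr0 : 0 ≤ (N - M) / N := div_nonneg (by linarith) hN0.le
  have hMM : M' ≤ M := by rw [hMd]; linarith
  have a1 : m^2 / (t^4 * M') ≤ 1 / w := by
    calc m^2 / (t^4 * M') ≤ (t^4 * D / 2)^2 / (t^4 * (D^2 * w * t^6 / 4)) := by gcongr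
      _ = 1 / w * (1 / t^2) := by field_simp; norm_num
      _ ≤ 1 / w * 1 := by
        gcongr
        rw [div_le_one (by positivity)]
        exact one_le_pow₀ ht
      _ = _ := mul_one _
  have a2 : 2 * m^3 / (M * M') ≤ 4 / w := by
    calc 2 * m^3 / (M * M') ≤ 2 * m^3 / (M' * M') := by gcongr
      _ ≤ 2 * (t^4 * D / 2)^3 / ((D^2 * w * t^6 / 4) * (D^2 * w * t^6 / 4)) := by gcongr
      _ = 4 / w * (1 / (D * w)) := by field_simp; norm_num
      _ ≤ 4 / w * 1 := by
        gcongr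
        rw [div_le_one (by positivity)]
        nlinarith
      _ = _ := mul_one _
  have a0 : 0 ≤ m^2 / (t^4 * M') + 2 * m^3 / (M * M') := by positivity
  calc _ ≤ 1 * (m^2 / (t^4 * M') + 2 * m^3 / (M * M')) := by gcongr
    _ ≤ 1 / w + 4 / w := by rw [one_mul]; gcongr
    _ = 5 / w := by ring

lemma core_e {t w lam L : ℝ} (ht : 4 ≤ t) (hw : 32 * Real.exp 9 ≤ w) (hl0 : 0 ≤ lam) (hl : lam ≤ t^2 / w)
    (hL : L = Real.exp 9 * lam + t) :
    lam * Real.exp (16 * L / t^4) ≤ lam + (32 * Real.exp 9 + 32) / w := by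
  have he : 1 ≤ Real.exp 9 := Real.one_le_exp (by norm_num)
  have hw1 : 1 ≤ w := by linarith
  have ht0 : 0 < t := by linarith
  have hL0 : 0 ≤ L := by rw [hL]; positivity
  have hLle : L ≤ Real.exp 9 * (t^2 / w) + t := by rw [hL]; gcongr
  have h16 : 16 * L / t^4 ≤ 1 := by
    rw [div_le_one (by positivity)]
    have : Real.exp 9 * (t^2 / w) ≤ t^2 / 32 := by
      rw [mul_div_assoc', div_le_div_iff₀ (by positivity) (by norm_num)]
      nlinarith [sq_nonneg t]
    have h2 : t^2 ≤ t^4 := pow_le_pow_right₀ (by linarith) (by norm_num)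
    have h3 : 64 * t ≤ t^4 := by
      have : 4^3 ≤ t^3 := by gcongr
      nlinarith
    nlinarith
  have hx0 : 0 ≤ 16 * L / t^4 := by positivity
  have hexp : Real.exp (16 * L / t^4) ≤ 1 + 2 * (16 * L / t^4) := by
    have := Real.abs_exp_sub_one_le (x := 16 * L / t^4) (by rw [abs_of_nonneg hx0]; exact h16)
    rw [abs_of_nonneg hx0] at this
    linarith [le_abs_self (Real.exp (16 * L / t^4) - 1)]
  have hk : lam * (2 * (16 * L / t^4)) ≤ (32 * Real.exp 9 + 32) / w := by
    calc lam * (2 * (16 * L / t^4)) ≤ (t^2 / w) * (2 * (16 * (Real.exp 9 * (t^2 / w) + t) / t^4)) := by gcongr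
      _ = (32 * Real.exp 9 * (1/w) + 32 * (1/ t)) / w := by field_simp; norm_num
      _ ≤ (32 * Real.exp 9 * 1 + 32 * 1) / w := by
        have b1 : 1 / w ≤ 1 := by rw [div_le_one (by linarith)]; exact hw1
        have b2 : 1 / t ≤ 1 := by rw [div_le_one (by linarith)]; linarith
        gcongr
      _ = _ := by ring
  nlinarith

/-- final bound on R -/
lemma core_R {t w D p m M N lam L Q : ℝ} (ht : 4 ≤ t) (hw : 32 * Real.exp 9 ≤ w) (hD : 1 ≤ D) (hp0 : 0 < p)
    (hp : D^2 * w ≤ p * t^2) (hN : N = t^4 * (t^4+1)/2) (hm0 : 0 ≤ m) (hm : m ≤ t^4 * D / 2)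
    (hM : p * N - t^5 ≤ M) (hMN : M ≤ N) (hlam : lam = m * ((N - M) / (M - 2 * m) * (2 * m / (t^4)^2)))
    (hL : L = Real.exp 9 * lam + t) (hQ : D^4 * Q / t^4 ≤ Real.exp 1 / w) :
    Real.exp (-(m^2 * (N - M)/(N*M))) *
        ((Real.exp (lam * Real.exp (16 * L / t^4)) + Real.exp (Real.exp 9 * lam - L)) *
          Real.exp ((4 * Real.exp 8)^3 * D ^ 4 * Q / t^4)) ≤
      Real.exp ((37 + 32 * Real.exp 9 + (4 * Real.exp 8)^3 * Real.exp 1) / w) +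
        Real.exp ((4 * Real.exp 8)^3 * Real.exp 1 / w - t) := by
  have he : 1 ≤ Real.exp 9 := Real.one_le_exp (by norm_num)
  have hw8 : 8 ≤ w := by linarith
  have ht1 : 1 ≤ t := by linarith
  obtain ⟨h1, h2⟩ := core_b ht1 hw8 hD hp0 hp hN hm hM
  have hM' : 0 < M - 2 * m := lt_of_lt_of_le (by positivity) h2
  have hM0 : 0 < M := by linarith
  have hN0 : 0 < N := by linarith
  have hNM : 0 ≤ N - M := by linarith
  have hl0 : 0 ≤ lam := by rw [hlam]; positivity
  have c := core_c ht1 hw8 hD hp0 hp hN hm0 hm hM hlam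
  have d := core_d ht1 hw8 hD hp0 hp hN hm0 hm hM hMN hlam
  have e := core_e ht hw hl0 c hL
  have hth : (4 * Real.exp 8)^3 * D ^ 4 * Q / t^4 ≤ (4 * Real.exp 8)^3 * Real.exp 1 / w := by
    calc _ = (4 * Real.exp 8)^3 * (D ^ 4 * Q / t^4) := by ring
      _ ≤ (4 * Real.exp 8)^3 * (Real.exp 1 / w) := by gcongr
      _ = _ := by ring
  have hz : 0 ≤ m^2 * (N - M)/(N*M) := by positivity
  rw [add_mul, mul_add, ← Real.exp_add, ← Real.exp_add, ← Real.exp_add, ← Real.exp_add]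
  apply add_le_add
  · apply Real.exp_le_exp.2
    have : (37 + 32 * Real.exp 9 + (4 * Real.exp 8)^3 * Real.exp 1) / w =
      5 / w + (32 * Real.exp 9 + 32) / w + (4 * Real.exp 8)^3 * Real.exp 1 / w := by ring
    rw [this]; linarith
  · apply Real.exp_le_exp.2
    rw [hL]; linarith

lemma core_Q {t w D p m M N r β : ℝ} (ht : 1 ≤ t) (hw : 16 ≤ w) (hD : 1 ≤ D) (hp0 : 0 < p)
    (hp : D^2 * w ≤ p * t^2) (hN : N = t^4 * (t^4+1)/2) (hm0 : 0 ≤ m) (hm : m ≤ t^4 * D / 2)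
    (hM : p * N - t^5 ≤ M) (hMN : M ≤ N) (hβ : β = (N - M) / (M - 2 * m)) (hr0 : 0 ≤ r) (hr : r ≤ 2 * D)
    (hω : t^4 * p ^ r / D^4 = w^2) :
    D^4 * (1 + β) ^ r / t^4 ≤ Real.exp 1 / w := by
  have hw8 : 8 ≤ w := by linarith
  have ht0 : 0 < t := by linarith
  obtain ⟨h1, h2⟩ := core_b ht hw8 hD hp0 hp hN hm hM
  have a := core_a ht hw8 hD hp0 hp hN hm hM
  have hM' : 0 < M - 2 * m := lt_of_lt_of_le (by positivity) h2
  have hN0 : 0 < N := by linarith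
  have hβ0 : 0 ≤ β := by rw [hβ]; exact div_nonneg (by linarith) hM'.le
  set x := 4 / (D * w * t) with hx
  have hx0 : 0 ≤ x := by positivity
  have hDwt : 16 ≤ D * w * t := by
      calc (16:ℝ) = 1 * 16 * 1 := by norm_num
        _ ≤ D * w * t := by gcongr
  have hxh : x ≤ 1/2 := by
    rw [hx, div_le_iff₀ (by positivity)]
    linarith
  have hxD : x * (4 * D) ≤ 1 := by
    have : x * (4 * D) = 16 / (w * t) := by rw [hx]; field_simp; norm_num
    rw [this, div_le_one (by positivity)]
    nlinarith
  have hb : 1 + β ≤ p⁻¹ * Real.exp (2 * x) := by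
    have h3 : 1 + β ≤ N / (M - 2 * m) := by
      rw [hβ, ← div_self hM'.ne', ← add_div]
      gcongr
      linarith
    have h4 : N / (M - 2 * m) ≤ N / (p * N * (1 - x)) := by
      have : 0 < p * N * (1 - x) := by
        have : 0 < 1 - x := by linarith
        positivity
      gcongr
    have h5 : N / (p * N * (1 - x)) = p⁻¹ * (1 / (1 - x)) := by
      have : 1 - x ≠ 0 := by linarith
      field_simp
    have h6 : 1 / (1 - x) ≤ Real.exp (2 * x) := by
      rw [div_le_iff₀ (by linarith)]
      have := Real.add_one_le_exp (2 * x)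
      nlinarith
    calc _ ≤ _ := h3
      _ ≤ _ := h4
      _ = _ := h5
      _ ≤ _ := by gcongr
  have hq : (1 + β) ^ r ≤ (p ^ r)⁻¹ * Real.exp 1 := by
    calc (1 + β) ^ r ≤ (p⁻¹ * Real.exp (2 * x)) ^ r := Real.rpow_le_rpow (by positivity) hb hr0
      _ = (p ^ r)⁻¹ * Real.exp (2 * x * r) := by
        rw [Real.mul_rpow (by positivity) (by positivity), Real.inv_rpow hp0.le, ← Real.exp_mul]
      _ ≤ _ := by
        have : 0 < p ^ r := Real.rpow_pos_of_pos hp0 r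
        gcongr
        nlinarith
  have hpr : 0 < p ^ r := Real.rpow_pos_of_pos hp0 r
  calc D^4 * (1 + β) ^ r / t^4 ≤ D^4 * ((p ^ r)⁻¹ * Real.exp 1) / t^4 := by gcongr
    _ = Real.exp 1 / (t^4 * p ^ r / D^4) := by field_simp
    _ = Real.exp 1 / w^2 := by rw [hω]
    _ ≤ Real.exp 1 / w := by
      gcongr
      nlinarith

end Rior

namespace Rior
open Finset

section gr
variable {V : Type*} [Fintype V] [DecidableEq V]

lemma pairs_card (F : Finset (Sym2 V)) (hd : ∀ e ∈ F, ¬ e.IsDiag) :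
    (univ.filter (fun q : V × V => s(q.1, q.2) ∈ F)).card = 2 * F.card := by
  rw [card_eq_sum_card_fiberwise (f := fun q : V × V => s(q.1,q.2)) (t := F)
    (fun q hq => by simpa using hq)]
  rw [sum_congr rfl (g := fun _ => 2), sum_const, smul_eq_mul, mul_comm]
  intro e he
  have hde := hd e he
  induction e using Sym2.ind with
  | _ x y =>
    have hxy : x ≠ y := by simpa using hde
    have : (univ.filter (fun q : V × V => s(q.1, q.2) ∈ F)).filter (fun q => s(q.1,q.2) = s(x,y)) = {(x,y),(y,x)} := by
      ext ⟨a, b⟩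
      simp only [mem_filter, mem_univ, true_and, mem_insert, mem_singleton, Prod.mk.injEq, Sym2.eq_iff]
      constructor
      · exact fun h => h.2
      · rintro (⟨rfl, rfl⟩ | ⟨rfl, rfl⟩)
        · exact ⟨he, Or.inl ⟨rfl, rfl⟩⟩
        · exact ⟨by rwa [Sym2.eq_swap], Or.inr ⟨rfl, rfl⟩⟩
    rw [this, card_pair]
    intro h; exact hxy (Prod.mk.inj h).1

lemma pairs_fst (F : Finset (Sym2 V)) :
    (univ.filter (fun q : V × V => s(q.1, q.2) ∈ F)).card = ∑ a : V, (univ.filter (fun b => s(a,b) ∈ F)).card := by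
  rw [card_eq_sum_card_fiberwise (f := fun q : V × V => q.1) (t := univ) (fun q hq => by simp)]
  apply sum_congr rfl
  intro a _
  apply card_nbij' (fun q => q.2) (fun b => (a, b))
  · rintro ⟨x, y⟩ h
    simp only [coe_filter, mem_filter, mem_univ, true_and, Set.mem_ofPred_eq] at h ⊢
    rw [← h.2]; exact h.1
  · intro b h
    simp only [coe_filter, mem_filter, mem_univ, true_and, Set.mem_ofPred_eq] at h ⊢
    exact ⟨h, trivial⟩
  · rintro ⟨x, y⟩ h
    simp only [coe_filter, mem_filter, mem_univ, true_and, Set.mem_ofPred_eq] at h ⊢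
    rw [h.2]
  · intro b h; rfl

lemma ins_count (E : Finset (Sym2 V)) (hd : ∀ e ∈ E, ¬ e.IsDiag) (D : ℕ)
    (hdeg : ∀ a : V, (univ.filter (fun b => s(a, b) ∈ E)).card ≤ D) (U : Finset V) :
    2 * (ins E U).card ≤ U.card * D := by
  rw [← pairs_card (ins E U) (fun e he => hd e (mem_filter.1 he).1), pairs_fst]
  calc ∑ a : V, (univ.filter (fun b => s(a,b) ∈ ins E U)).card
      = ∑ a ∈ U, (univ.filter (fun b => s(a,b) ∈ ins E U)).card := by
        symm
        apply sum_subset (subset_univ _)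
        intro a _ ha
        rw [card_eq_zero, filter_eq_empty_iff]
        intro b _ hb
        exact ha ((mem_filter.1 hb).2 a (by simp))
    _ ≤ ∑ a ∈ U, D := by
        apply sum_le_sum
        intro a _
        refine le_trans (card_le_card ?_) (hdeg a)
        intro b hb
        simp only [mem_filter, mem_univ, true_and] at hb ⊢
        exact (mem_filter.1 hb).1
    _ = _ := by simp

open Classical in
/-- edge finset -/
noncomputable def EF (H : SimpleGraph V) : Finset (Sym2 V) := H.edgeSet.toFinset

lemma mem_EF {H : SimpleGraph V} {e : Sym2 V} : e ∈ EF H ↔ e ∈ H.edgeSet := by simp [EF]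

lemma EF_card (H : SimpleGraph V) : (EF H).card = H.edgeSet.ncard := by
  rw [← Set.ncard_coe_finset]
  congr 1
  ext e
  simp [mem_EF]

lemma EF_diag (H : SimpleGraph V) : ∀ e ∈ EF H, ¬ e.IsDiag := fun e he =>
  H.not_isDiag_of_mem_edgeSet (mem_EF.1 he)

lemma EF_deg (H : SimpleGraph V) (a : V) : (univ.filter (fun b => s(a, b) ∈ EF H)).card ≤ maxDeg H := by
  have : (univ.filter (fun b => s(a, b) ∈ EF H)).card = (H.neighborSet a).ncard := by
    rw [← Set.ncard_coe_finset]
    congr 1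
    ext b
    simp [mem_EF]
  rw [this]
  exact Finset.le_sup (f := fun v => (H.neighborSet v).ncard) (mem_univ a)

lemma sub_le (H : SimpleGraph V) (H' : H.Subgraph) (h : 2 < H'.verts.ncard) :
    (H'.edgeSet.ncard : ℝ) / ((H'.verts.ncard : ℝ) - 2) ≤ 2 * maxDeg H := by
  classical
  have h1 : H'.edgeSet.ncard ≤ (ins (EF H) H'.verts.toFinset).card := by
    rw [← Set.ncard_coe_finset]
    apply Set.ncard_le_ncard _ (Set.toFinite _)
    intro e he
    simp only [ins, coe_filter, Set.mem_ofPred_eq, mem_EF, Set.mem_toFinset]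
    exact ⟨H'.edgeSet_subset he, fun x hx => H'.mem_verts_of_mem_edge he hx⟩
  have h2 := ins_count (EF H) (EF_diag H) (maxDeg H) (EF_deg H) H'.verts.toFinset
  rw [← Set.ncard_eq_toFinset_card'] at h2
  have h3 : 2 * H'.edgeSet.ncard ≤ H'.verts.ncard * maxDeg H := by omega
  have h3' : 2 * (H'.edgeSet.ncard : ℝ) ≤ H'.verts.ncard * maxDeg H := by exact_mod_cast h3
  have h' : (3:ℝ) ≤ H'.verts.ncard := by exact_mod_cast h
  rw [div_le_iff₀ (by linarith)]
  have : (0:ℝ) ≤ maxDeg H := by positivity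
  nlinarith

lemma mR_le (H : SimpleGraph V) : mR H ≤ 2 * maxDeg H := by
  apply Real.sSup_le _ (by positivity)
  rintro x ⟨H', h, rfl⟩
  exact sub_le H H' h

lemma mR_nonneg (H : SimpleGraph V) : 0 ≤ mR H := by
  apply Real.sSup_nonneg
  rintro x ⟨H', h, rfl⟩
  have h' : (3:ℝ) ≤ H'.verts.ncard := by exact_mod_cast h
  apply div_nonneg (by positivity) (by linarith)

lemma ins_mR (H : SimpleGraph V) (U : Finset V) (hU : 3 ≤ U.card) :
    ((ins (EF H) U).card : ℝ) ≤ mR H * ((U.card : ℝ) - 2) := by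
  have hU' : (3:ℝ) ≤ U.card := by exact_mod_cast hU
  rw [← div_le_iff₀ (by linarith)]
  apply le_csSup
  · refine ⟨2 * maxDeg H, ?_⟩
    rintro x ⟨H', h, rfl⟩
    exact sub_le H H' h
  · refine ⟨(⊤ : H.Subgraph).induce (U : Set V), ?_, ?_⟩
    · simp only [SimpleGraph.Subgraph.induce_verts, Set.ncard_coe_finset]; omega
    · simp only [SimpleGraph.Subgraph.induce_verts, Set.ncard_coe_finset]
      congr 2
      rw [← Set.ncard_coe_finset]
      congr 1
      ext e
      induction e using Sym2.ind with
      | _ x y =>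
        simp [ins, mem_EF]
        tauto

lemma two_le_mR (H : SimpleGraph V) (h : Fintype.card V < 2 * H.edgeSet.ncard) : 2 ≤ mR H ∧ 2 ≤ maxDeg H := by
  have h1 := pairs_card (EF H) (EF_diag H)
  rw [pairs_fst, EF_card] at h1
  have : ∃ a : V, 1 < (univ.filter (fun b => s(a, b) ∈ EF H)).card := by
    by_contra hcon
    push Not at hcon
    have : ∑ a : V, (univ.filter (fun b => s(a,b) ∈ EF H)).card ≤ ∑ a : V, 1 := sum_le_sum fun a _ => hcon a
    simp only [sum_const, card_univ, smul_eq_mul, mul_one] at this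
    omega
  obtain ⟨a, ha⟩ := this
  refine ⟨?_, le_trans ha (EF_deg H a)⟩
  obtain ⟨b, hb, c, hc, hbc⟩ := one_lt_card.1 ha
  simp only [mem_filter, mem_univ, true_and] at hb hc
  have hab : a ≠ b := by intro h; subst h; exact EF_diag H _ hb (by simp)
  have hac : a ≠ c := by intro h; subst h; exact EF_diag H _ hc (by simp)
  have hU : ({a, b, c} : Finset V).card = 3 := card_eq_three.2 ⟨a, b, c, hab, hac, hbc, rfl⟩
  have h3 := ins_mR H {a, b, c} hU.ge
  have h4 : ({s(a,b), s(a,c)} : Finset (Sym2 V)) ⊆ ins (EF H) {a,b,c} := by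
    intro e he
    simp only [mem_insert, mem_singleton] at he
    rcases he with rfl | rfl <;> simp [ins, hb, hc]
  have h5 : ({s(a,b), s(a,c)} : Finset (Sym2 V)).card = 2 := by
    apply card_pair
    intro h
    rw [Sym2.eq_iff] at h
    rcases h with ⟨_, h⟩ | ⟨h, _⟩
    · exact hbc h
    · exact hac h
  have h6 := card_le_card h4
  rw [h5] at h6
  have h7 : (2:ℝ) ≤ (ins (EF H) {a,b,c}).card := by exact_mod_cast h6
  rw [hU] at h3
  push_cast at h3
  linarith

end gr
end Rior

namespace Rior
open Finset

lemma bern_true {p : ℝ} (hp1 : p ≤ 1) : bernoulliMeasure p {true} = ENNReal.ofReal p := by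
  have : ENNReal.ofReal p ≤ 1 := by rw [← ENNReal.ofReal_one]; exact ENNReal.ofReal_le_ofReal hp1
  simp [bernoulliMeasure, min_eq_left this]

lemma bern_false {p : ℝ} (hp0 : 0 ≤ p) (hp1 : p ≤ 1) : bernoulliMeasure p {false} = ENNReal.ofReal (1 - p) := by
  have : ENNReal.ofReal p ≤ 1 := by rw [← ENNReal.ofReal_one]; exact ENNReal.ofReal_le_ofReal hp1
  rw [ENNReal.ofReal_sub _ hp0, ENNReal.ofReal_one]
  simp [bernoulliMeasure, min_eq_left this]

instance bern_prob (p : ℝ) : IsProbabilityMeasure (bernoulliMeasure p) := ⟨by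
  simp only [bernoulliMeasure, Measure.add_apply, Measure.smul_apply, measure_univ, smul_eq_mul, mul_one]
  exact add_tsub_cancel_of_le (min_le_right _ _)⟩

instance gnp_prob (n : ℕ) (p : ℝ) : IsProbabilityMeasure (gnp n p) := by
  unfold gnp; infer_instance

lemma gnp_single {n : ℕ} {p : ℝ} (hp0 : 0 ≤ p) (hp1 : p ≤ 1) (ω : Sym2 (Fin n) → Bool) :
    gnp n p {ω} = ENNReal.ofReal (p ^ (univ.filter (fun e => ω e = true)).card *
      (1 - p) ^ (Fintype.card (Sym2 (Fin n)) - (univ.filter (fun e => ω e = true)).card)) := by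
  unfold gnp
  rw [Measure.pi_singleton]
  have : ∀ e, bernoulliMeasure p {ω e} = ENNReal.ofReal (if ω e = true then p else 1 - p) := by
    intro e
    cases h : ω e
    · simp [bern_false hp0 hp1]
    · simp [bern_true hp1]
  simp_rw [this]
  rw [← ENNReal.ofReal_prod_of_nonneg (fun e _ => by split_ifs <;> linarith)]
  congr 1
  rw [prod_ite, prod_const, prod_const]
  congr 2
  rw [filter_not, card_sdiff_of_subset (filter_subset _ _), card_univ]

lemma contains_of {n : ℕ} (H : SimpleGraph (Fin n)) (ω : Sym2 (Fin n) → Bool) (π : Equiv.Perm (Fin n))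
    (h : (EF H).image (Sym2.map π) ⊆ univ.filter (fun e => ω e = true)) : ContainsCopy H (graphOf ω) := by
  refine ⟨π, π.injective, fun u v huv => ?_⟩
  have : Sym2.map π s(u, v) ∈ (EF H).image (Sym2.map π) := mem_image_of_mem _ (mem_EF.2 huv)
  have := h this
  simp only [mem_filter, mem_univ, true_and, Sym2.map_mk] at this
  simp only [graphOf, SimpleGraph.fromRel_adj]
  exact ⟨fun h => huv.ne (π.injective h), Or.inl this⟩

lemma gnp_bad {n : ℕ} (H : SimpleGraph (Fin n)) {p : ℝ} (hp0 : 0 ≤ p) (hp1 : p ≤ 1) :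
    gnp n p {ω | ¬ ContainsCopy H (graphOf ω)} ≤ ENNReal.ofReal
      (∑ A ∈ univ.filter (fun A => ∀ π : Equiv.Perm (Fin n), ¬ (EF H).image (Sym2.map π) ⊆ A),
        p ^ A.card * (1 - p) ^ (Fintype.card (Sym2 (Fin n)) - A.card)) := by
  classical
  set g : Finset (Sym2 (Fin n)) → ℝ := fun A => p ^ A.card * (1 - p) ^ (Fintype.card (Sym2 (Fin n)) - A.card) with hg
  have hg0 : ∀ A, 0 ≤ g A := fun A => by
    have : 0 ≤ 1 - p := by linarith
    positivity
  set S : Finset (Sym2 (Fin n) → Bool) := univ.filter (fun ω => ¬ ContainsCopy H (graphOf ω)) with hS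
  have e1 : {ω : Sym2 (Fin n) → Bool | ¬ ContainsCopy H (graphOf ω)} = ↑S := by
    ext ω; simp [hS]
  rw [e1, ← sum_measure_singleton]
  simp_rw [gnp_single hp0 hp1]
  rw [← ENNReal.ofReal_sum_of_nonneg (fun ω _ => hg0 _)]
  apply ENNReal.ofReal_le_ofReal
  have hinj : Set.InjOn (fun ω : Sym2 (Fin n) → Bool => univ.filter (fun e => ω e = true)) (S : Set _) := by
    intro ω _ ω' _ h
    funext e
    have := Finset.ext_iff.1 h e
    simp only [mem_filter, mem_univ, true_and] at this
    exact Bool.eq_iff_iff.2 this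
  have := sum_image (f := g) hinj
  calc _ = _ := this.symm
    _ ≤ _ := by
      apply sum_le_sum_of_subset_of_nonneg
      · intro A hA
        obtain ⟨ω, hω, rfl⟩ := mem_image.1 hA
        refine mem_filter.2 ⟨mem_univ _, fun π hπ => ?_⟩
        exact (mem_filter.1 hω).2 (contains_of H ω π hπ)
      · intro A _ _; exact hg0 A

lemma final_bound {n : ℕ} (H : SimpleGraph (Fin n)) {p t w : ℝ} (hp0 : 0 ≤ p) (hp1 : p ≤ 1)
    (hE : (n : ℝ) / 2 < (H.edgeSet.ncard : ℝ)) (ht : 4 ≤ t) (htn : t^4 = n)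
    (hw : (4 * Real.exp 8) * Real.exp 1 + 32 * Real.exp 9 ≤ w)
    (hω : (n:ℝ) * p ^ mR H / (maxDeg H : ℝ) ^ 4 = w^2) :
    gnp n p {ω | ¬ ContainsCopy H (graphOf ω)} ≤ ENNReal.ofReal
      (Real.exp ((37 + 32 * Real.exp 9 + (4 * Real.exp 8)^3 * Real.exp 1) / w) +
        Real.exp ((4 * Real.exp 8)^3 * Real.exp 1 / w - t) - 1 + 1 / t^2) := by
  refine (gnp_bad H hp0 hp1).trans (ENNReal.ofReal_le_ofReal ?_)
  have he9 : 1 ≤ Real.exp 9 := Real.one_le_exp (by norm_num)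
  have he8 : 0 < (4 * Real.exp 8) * Real.exp 1 := by positivity
  have hw1 : 32 * Real.exp 9 ≤ w := by linarith
  have hw16 : 16 ≤ w := by linarith
  have ht0 : 0 < t := by linarith
  have ht1 : 1 ≤ t := by linarith
  have hn' : (0:ℝ) < n := by rw [← htn]; positivity
  have hn0 : 0 < n := by exact_mod_cast hn'
  have : Nonempty (Fin n) := ⟨⟨0, hn0⟩⟩
  set m := H.edgeSet.ncard with hm
  set D := maxDeg H with hD
  set r := mR H with hr
  obtain ⟨hr2, hD2⟩ := two_le_mR H (by
    rw [Fintype.card_fin]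
    have : (n:ℝ) < 2 * H.edgeSet.ncard := by linarith
    exact_mod_cast this)
  rw [← hr] at hr2
  rw [← hD] at hD2
  have hD1 : (1:ℝ) ≤ D := by exact_mod_cast (by omega : 1 ≤ D)
  have hp : 0 < p := by
    rcases hp0.lt_or_eq with h | h
    · exact h
    · rw [← h, Real.zero_rpow (by linarith)] at hω
      simp at hω
      nlinarith
  have hpt : (D:ℝ)^2 * w ≤ p * t^2 := by
    have h1 : p ^ r ≤ p^2 := by
      rw [← Real.rpow_natCast p 2]
      exact Real.rpow_le_rpow_of_exponent_ge hp hp1 (by exact_mod_cast hr2)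
    have h2 : w^2 * (D:ℝ)^4 ≤ n * p^2 := by
      rw [← hω]
      rw [div_mul_cancel₀ _ (by positivity)]
      gcongr
    rw [← htn] at h2
    apply (sq_le_sq₀ (by positivity) (by positivity)).1
    nlinarith
  set N := Fintype.card (Sym2 (Fin n)) with hN
  have hNr : (N:ℝ) = t^4 * (t^4+1)/2 := by
    rw [hN, Sym2.card, Fintype.card_fin, htn, Nat.cast_choose_two]
    push_cast; ring
  have hmr : (m:ℝ) ≤ t^4 * D / 2 := by
    have h := ins_count (EF H) (EF_diag H) (maxDeg H) (EF_deg H) univ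
    have : ins (EF H) univ = EF H := by ext e; simp [ins]
    rw [this, EF_card, card_univ, Fintype.card_fin] at h
    have h' : 2 * (m:ℝ) ≤ n * D := by exact_mod_cast h
    rw [htn]; linarith
  set M : ℕ := ⌈p * N - t^5⌉₊ with hM
  have hMle : p * N - t^5 ≤ M := Nat.le_ceil _
  have hN0 : (0:ℝ) ≤ N := by positivity
  have hMN : M ≤ N := by
    apply Nat.ceil_le.2
    have : p * (N:ℝ) ≤ 1 * N := by gcongr
    have : 0 < t^5 := by positivity
    linarith
  have hMN' : (M:ℝ) ≤ N := by exact_mod_cast hMN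
  have hm0 : (0:ℝ) ≤ m := by positivity
  obtain ⟨b1, b2⟩ := core_b ht1 (by linarith) hD1 hp hpt hNr hmr hMle
  have h2m : 2 * m < M := by
    have : (0:ℝ) < M - 2 * m := lt_of_lt_of_le (by positivity) b2
    have : (2 * m : ℝ) < M := by linarith
    exact_mod_cast this
  set β : ℝ := ((N:ℝ) - M) / ((M:ℝ) - 2 * m) with hβ
  set lam : ℝ := m * (β * (2 * m / (n:ℝ)^2)) with hlam
  set L : ℝ := Real.exp 9 * lam + t with hL
  have hβ0 : 0 ≤ β := by
    apply div_nonneg (by linarith)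
    exact le_trans (by positivity) b2
  have hlam0 : 0 ≤ lam := by positivity
  have hQ := core_Q ht1 hw16 hD1 hp hpt hNr hm0 hmr hMle hMN' hβ (by linarith) (mR_le H)
    (by rw [htn]; exact hω)
  have hQ0 : 0 ≤ (1 + β) ^ r := by positivity
  have hw0 : 0 < w := by linarith
  have hfb := finite_bound (EF H) m D M (EF_card H) (EF_diag H) (pairs_card _ (EF_diag H) |>.trans (by rw [EF_card])).le
    (EF_deg H) (by omega) N n rfl (Fintype.card_fin n) h2m hMN β ((1 + β) ^ r) L lam hβ (by positivity) hlam hQ0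
    (by
      intro U hU
      rw [← Real.rpow_natCast, ← Real.rpow_natCast, ← Real.rpow_mul (by positivity)]
      apply Real.rpow_le_rpow_of_exponent_le (by linarith)
      have := ins_mR H U hU
      rw [Nat.cast_sub (by omega)]
      push_cast
      exact this)
    (by
      calc (4 * Real.exp 8) * (D:ℝ) ^ 4 * (1 + β) ^ r / n = (4 * Real.exp 8) * ((D:ℝ)^4 * (1 + β) ^ r / t^4) := by
            rw [htn]; ring
        _ ≤ (4 * Real.exp 8) * (Real.exp 1 / w) := by gcongr
        _ ≤ 1 := by
          rw [mul_div_assoc', div_le_one hw0]; linarith)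
  have hR := core_R ht hw1 hD1 hp hpt hNr hm0 hmr hMle hMN' (lam := lam) (by rw [hlam, hβ, htn]) hL hQ
  have hpb := product_bound (fun A => ∀ π : Equiv.Perm (Fin n), ¬ (EF H).image (Sym2.map π) ⊆ A)
    (fun A B hAB hB π hπ => hB π (hπ.trans hAB)) p hp0 hp1 M _ (t^5) (by positivity)
    (by
      intro k hk
      rw [← hN, mul_comm (N:ℝ) p]
      exact (Nat.lt_ceil.1 hk).le)
    hfb hMN
  refine hpb.trans ?_
  rw [htn] at hR
  have hlast : (N:ℝ) / (t^5)^2 ≤ 1 / t^2 := by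
    rw [div_le_div_iff₀ (by positivity) (by positivity), hNr]
    have : 1 ≤ t^4 := one_le_pow₀ ht1
    have h2 : 0 < t^6 := by positivity
    have e1 : t ^ 4 * (t ^ 4 + 1) / 2 * t ^ 2 = t^6 * ((t^4 + 1)/2) := by ring
    have e2 : 1 * (t^5)^2 = t^6 * t^4 := by ring
    rw [e1, e2]
    gcongr
    linarith
  exact add_le_add (sub_le_sub_right hR 1) hlast

end Rior


theorem stmt_5 (H : ∀ n : ℕ, SimpleGraph (Fin n)) (p : ℕ → ℝ)
    (hp : ∀ n, 0 ≤ p n ∧ p n < 1)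
    (hE : ∀ᶠ n : ℕ in atTop, (n : ℝ) / 2 < ((H n).edgeSet.ncard : ℝ))
    (hcond : Tendsto
      (fun n : ℕ => (n : ℝ) * p n ^ mR (H n) / (maxDeg (H n) : ℝ) ^ 4) atTop atTop) :
    Tendsto (fun n : ℕ => gnp n (p n) {ω | ContainsCopy (H n) (graphOf ω)}) atTop (𝓝 1) := by
  set w : ℕ → ℝ := fun n => √((n : ℝ) * p n ^ mR (H n) / (maxDeg (H n) : ℝ) ^ 4) with hw
  set t : ℕ → ℝ := fun n => √(√(n : ℝ)) with ht
  have hwt : Tendsto w atTop atTop := Real.tendsto_sqrt_atTop.comp hcond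
  have htt : Tendsto t atTop atTop :=
    Real.tendsto_sqrt_atTop.comp (Real.tendsto_sqrt_atTop.comp tendsto_natCast_atTop_atTop)
  set g : ℕ → ℝ := fun n =>
    Real.exp ((37 + 32 * Real.exp 9 + (4 * Real.exp 8)^3 * Real.exp 1) / w n) +
        Real.exp ((4 * Real.exp 8)^3 * Real.exp 1 / w n - t n) - 1 + 1 / (t n)^2 with hg
  have hg0 : Tendsto g atTop (𝓝 0) := by
    have h1 : Tendsto (fun n => Real.exp ((37 + 32 * Real.exp 9 + (4 * Real.exp 8)^3 * Real.exp 1) / w n))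
        atTop (𝓝 1) := by
      have := (Real.continuous_exp.tendsto 0).comp (hwt.const_div_atTop (37 + 32 * Real.exp 9 + (4 * Real.exp 8)^3 * Real.exp 1))
      rwa [Real.exp_zero] at this
    have h2 : Tendsto (fun n => Real.exp ((4 * Real.exp 8)^3 * Real.exp 1 / w n - t n)) atTop (𝓝 0) := by
      apply Real.tendsto_exp_atBot.comp
      exact (hwt.const_div_atTop ((4 * Real.exp 8)^3 * Real.exp 1)).add_atBot (tendsto_neg_atTop_atBot.comp htt)
    have h3 : Tendsto (fun n => 1 / (t n)^2) atTop (𝓝 0) :=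
      ((tendsto_pow_atTop (by norm_num)).comp htt).const_div_atTop 1
    have := ((h1.add h2).sub_const 1).add h3
    simpa [hg] using this
  have hbad : Tendsto (fun n : ℕ => gnp n (p n) {ω | ¬ ContainsCopy (H n) (graphOf ω)}) atTop (𝓝 0) := by
    have hlim : Tendsto (fun n => ENNReal.ofReal (g n)) atTop (𝓝 0) := by
      have := (ENNReal.continuous_ofReal.tendsto 0).comp hg0
      rwa [ENNReal.ofReal_zero] at this
    refine tendsto_of_tendsto_of_tendsto_of_le_of_le' tendsto_const_nhds hlim
      (Eventually.of_forall fun n => zero_le) ?_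
    filter_upwards [hE, hwt.eventually_ge_atTop ((4 * Real.exp 8) * Real.exp 1 + 32 * Real.exp 9),
      htt.eventually_ge_atTop 4] with n h1 h2 h3
    refine Rior.final_bound (H n) (hp n).1 (hp n).2.le h1 h3 ?_ h2 ?_
    · have : t n ^ 4 = (t n ^ 2) ^ 2 := by ring
      rw [this, ht]
      rw [Real.sq_sqrt (Real.sqrt_nonneg _), Real.sq_sqrt (Nat.cast_nonneg n)]
    · rw [hw]
      rw [Real.sq_sqrt]
      have := Real.rpow_nonneg (hp n).1 (mR (H n))
      positivity
  have hgood : ∀ n, gnp n (p n) {ω | ContainsCopy (H n) (graphOf ω)} =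
      1 - gnp n (p n) {ω | ¬ ContainsCopy (H n) (graphOf ω)} := by
    intro n
    rw [← prob_compl_eq_one_sub (Set.toFinite _).measurableSet]
    congr 1
    ext ω; simp
  simp_rw [hgood]
  have := ENNReal.Tendsto.sub (tendsto_const_nhds (x := (1:ENNReal)) (f := atTop)) hbad (Or.inl ENNReal.one_ne_top)
  simpa using this
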